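/- Suppose λ < 0 and that the set Ω_a^+ is connected. Then any two nontrivial Dirichlet weak solutions of (P_λ) coincide on Ω; in other words, (P_λ) has at most one nontrivial solution. -/

import Mathlib

open MeasureTheory RealInnerProductSpace

noncomputable section

/-- A test function: smooth, compactly supported, with support contained in `Ω`. -/
def IsTestFun {N : ℕ} (Ω : Set (EuclideanSpace ℝ (Fin N)))
    (φ : EuclideanSpace ℝ (Fin N) → ℝ) : Prop :=
  ContDiff ℝ (⊤ : ℕ∞) φ ∧ HasCompactSupport φ ∧ tsupport φ ⊆ Ω

/-- A Dirichlet weak solution of `(P_λ)` with exponent `q` and weight `a`: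
continuous on the closure of `Ω`, continuously differentiable in `Ω`, nonnegative in `Ω`,
vanishing on the boundary, with `∫_Ω ‖∇u‖^p < ∞`, satisfying the weak form of
`-Δ_p u = λ u^{p-1} + a u^{q-1}`. -/
def DirichletSol {N : ℕ} (Ω : Set (EuclideanSpace ℝ (Fin N))) (p q lam : ℝ)
    (a u : EuclideanSpace ℝ (Fin N) → ℝ) : Prop :=
  ContinuousOn u (closure Ω) ∧
  (∀ x ∈ Ω, DifferentiableAt ℝ u x) ∧
  ContinuousOn (fun x => gradient u x) Ω ∧
  (∀ x ∈ Ω, 0 ≤ u x) ∧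
  (∀ x ∈ frontier Ω, u x = 0) ∧
  IntegrableOn (fun x => ‖gradient u x‖ ^ p) Ω ∧
  ∀ φ : EuclideanSpace ℝ (Fin N) → ℝ, IsTestFun Ω φ →
    (∫ x in Ω, ‖gradient u x‖ ^ (p - 2) * ⟪gradient u x, gradient φ x⟫)
      = ∫ x in Ω, (lam * u x ^ (p - 1) + a x * u x ^ (q - 1)) * φ x

/-- `λ₁`: the infimum of `∫_Ω ‖∇φ‖^p` over test functions normalized in `L^p`. -/
def lambda1 {N : ℕ} (Ω : Set (EuclideanSpace ℝ (Fin N))) (p : ℝ) : ℝ :=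
  sInf { E : ℝ | ∃ φ : EuclideanSpace ℝ (Fin N) → ℝ, IsTestFun Ω φ ∧
    (∫ x in Ω, |φ x| ^ p) = 1 ∧ E = ∫ x in Ω, ‖gradient φ x‖ ^ p }

/-- `λ*(a,r)`: the infimum of `∫_Ω ‖∇φ‖^p` over normalized test functions with
`∫_Ω a |φ|^r ≥ 0`. -/
def lambdaStar {N : ℕ} (Ω : Set (EuclideanSpace ℝ (Fin N))) (p r : ℝ)
    (a : EuclideanSpace ℝ (Fin N) → ℝ) : ℝ :=
  sInf { E : ℝ | ∃ φ : EuclideanSpace ℝ (Fin N) → ℝ, IsTestFun Ω φ ∧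
    (∫ x in Ω, |φ x| ^ p) = 1 ∧ (0 ≤ ∫ x in Ω, a x * |φ x| ^ r) ∧
    E = ∫ x in Ω, ‖gradient φ x‖ ^ p }

section WeakFormulation

open Filter Topology Metric
open scoped Convolution

variable {E : Type*} [NormedAddCommGroup E]

theorem continuous_rpow_norm_smul [NormedSpace ℝ E] {p : ℝ} (hp : 1 < p) :
    Continuous fun y : E => ‖y‖ ^ (p - 2) • y := by
  rw [continuous_iff_continuousAt]
  intro y
  rcases eq_or_ne y 0 with rfl | hy
  · have h0 : ‖(0 : E)‖ ^ (p - 2) • (0 : E) = 0 := smul_zero _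
    rw [ContinuousAt, h0, tendsto_zero_iff_norm_tendsto_zero]
    have h1 : Tendsto (fun z : E => ‖z‖ ^ (p - 1)) (𝓝 0) (𝓝 0) := by
      have h2 : ContinuousAt (fun z : E => ‖z‖ ^ (p - 1)) 0 :=
        continuous_norm.continuousAt.rpow_const (Or.inr (by linarith))
      have h3 := h2.tendsto
      rwa [norm_zero, Real.zero_rpow (by linarith)] at h3
    refine h1.congr fun z => ?_
    rw [norm_smul, Real.norm_of_nonneg (by positivity)]
    rcases eq_or_ne z 0 with rfl | hz
    · simp [Real.zero_rpow (show p - 1 ≠ 0 by linarith)]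
    · nth_rewrite 3 [← Real.rpow_one ‖z‖]
      rw [← Real.rpow_add (norm_pos_iff.2 hz)]
      ring_nf
  · exact (continuous_norm.continuousAt.rpow_const
      (Or.inl (norm_ne_zero_iff.2 hy))).smul continuousAt_id

theorem contDiff_one_indicator [NormedSpace ℝ E] {Ω K : Set E} (hΩ : IsOpen Ω) (hK : IsCompact K)
    (hKΩ : K ⊆ Ω) {φ : E → ℝ} {φ' : E → E →L[ℝ] ℝ} (hφ : ∀ x ∈ Ω, HasFDerivAt φ (φ' x) x)
    (hφ' : ContinuousOn φ' Ω) (h0 : ∀ x ∈ Ω, x ∉ K → φ x = 0) :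
    ContDiff ℝ 1 (Ω.indicator φ) ∧ tsupport (Ω.indicator φ) ⊆ K := by
  have hsupp : ∀ x ∉ K, Ω.indicator φ x = 0 := fun x hx => by
    by_cases h : x ∈ Ω
    · rw [Set.indicator_of_mem h, h0 x h hx]
    · exact Set.indicator_of_notMem h _
  refine ⟨contDiff_iff_contDiffAt.2 fun x => ?_,
    closure_minimal (fun x hx => not_imp_comm.1 (hsupp x) hx) hK.isClosed⟩
  by_cases hx : x ∈ K
  · refine contDiffAt_one_iff.2 ⟨φ', Ω, hΩ.mem_nhds (hKΩ hx), hφ', fun y hy => ?_⟩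
    refine (hφ y hy).congr_of_eventuallyEq ?_
    filter_upwards [hΩ.mem_nhds hy] with z hz using Set.indicator_of_mem hz φ
  · refine (contDiffAt_const (c := (0 : ℝ))).congr_of_eventuallyEq ?_
    filter_upwards [hK.isClosed.isOpen_compl.mem_nhds hx] with z hz using hsupp z hz

variable [InnerProductSpace ℝ E] [FiniteDimensional ℝ E] [MeasurableSpace E] [BorelSpace E]
  {μ : Measure E} [μ.IsAddHaarMeasure]

theorem norm_normed_convolution_le {G : Type*} [NormedAddCommGroup G] [NormedSpace ℝ G]
    [CompleteSpace G] (ρ : ContDiffBump (0 : E)) {f : E → G} (hf : Continuous f)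
    (hfc : HasCompactSupport f) {M : ℝ} (hM : ∀ x, ‖f x‖ ≤ M) (x : E) :
    ‖(ρ.normed μ ⋆[ContinuousLinearMap.lsmul ℝ ℝ, μ] f) x‖ ≤ 3 * M := by
  have h1 : dist ((ρ.normed μ ⋆[ContinuousLinearMap.lsmul ℝ ℝ, μ] f) x) (f x) ≤ 2 * M := by
    refine ContDiffBump.dist_normed_convolution_le
      (hf.integrable_of_hasCompactSupport hfc).aestronglyMeasurable fun y _ => ?_
    rw [dist_eq_norm]
    linarith [norm_sub_le (f y) (f x), hM x, hM y]
  rw [dist_eq_norm] at h1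
  have h2 := norm_add_le ((ρ.normed μ ⋆[ContinuousLinearMap.lsmul ℝ ℝ, μ] f) x - f x) (f x)
  rw [sub_add_cancel] at h2
  linarith [hM x]

theorem exists_smooth_approx {Ω : Set E} (hΩ : IsOpen Ω) {φ : E → ℝ} (hφ : ContDiff ℝ 1 φ)
    (hφc : HasCompactSupport φ) (hφΩ : tsupport φ ⊆ Ω) :
    ∃ (K : Set E) (M : ℝ) (ψ : ℕ → E → ℝ), IsCompact K ∧ K ⊆ Ω ∧
      (∀ n, ContDiff ℝ (⊤ : ℕ∞) (ψ n)) ∧ (∀ n, tsupport (ψ n) ⊆ K) ∧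
      (∀ n x, ‖ψ n x‖ ≤ M) ∧ (∀ n x, ‖fderiv ℝ (ψ n) x‖ ≤ M) ∧
      (∀ x, Tendsto (fun n => ψ n x) atTop (𝓝 (φ x))) ∧
      (∀ x, Tendsto (fun n => fderiv ℝ (ψ n) x) atTop (𝓝 (fderiv ℝ φ x))) := by
  let μ : Measure E := volume
  obtain ⟨δ, hδ, hδΩ⟩ := hφc.isCompact.exists_cthickening_subset_open hΩ hφΩ
  have hdc : Continuous (fderiv ℝ φ) := hφ.continuous_fderiv one_ne_zero
  obtain ⟨M₁, hM₁⟩ := hφc.exists_bound_of_continuous hφ.continuous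
  obtain ⟨M₂, hM₂⟩ := (hφc.fderiv (𝕜 := ℝ)).exists_bound_of_continuous hdc
  let ρ : ℕ → ContDiffBump (0 : E) := fun n =>
    { rIn := δ / (n + 2) / 2
      rOut := δ / (n + 2)
      rIn_pos := by positivity
      rIn_lt_rOut := half_lt_self (by positivity) }
  have hρ0 : Tendsto (fun n => (ρ n).rOut) atTop (𝓝 0) := by
    have := (tendsto_const_div_atTop_nhds_zero_nat δ).comp (tendsto_add_atTop_nat 2)
    refine this.congr fun n => ?_
    simp [ρ]
  have hρδ : ∀ n, (ρ n).rOut ≤ δ := fun n => by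
    change δ / ((n : ℝ) + 2) ≤ δ
    exact div_le_self hδ.le (by have : (0 : ℝ) ≤ n := n.cast_nonneg; linarith)
  let L := ContinuousLinearMap.lsmul ℝ ℝ (E := ℝ)
  let ψ : ℕ → E → ℝ := fun n => (ρ n).normed μ ⋆[L, μ] φ
  have hder : ∀ n x, fderiv ℝ (ψ n) x
      = ((ρ n).normed μ ⋆[ContinuousLinearMap.lsmul ℝ ℝ, μ] fderiv ℝ φ) x := fun n x => by
    have := (hφc.hasFDerivAt_convolution_right (μ := μ) L (f := (ρ n).normed μ)
      (((ρ n).continuous_normed).locallyIntegrable) hφ x).fderiv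
    rw [this]
    congr 1
  refine ⟨cthickening δ (tsupport φ), max (3 * M₁) (3 * M₂), ψ, hφc.isCompact.cthickening, hδΩ,
    fun n => ?_, fun n => ?_, fun n x => ?_, fun n x => ?_, fun x => ?_, fun x => ?_⟩
  · exact (ρ n).hasCompactSupport_normed.contDiff_convolution_left L ((ρ n).contDiff_normed)
      hφ.continuous.locallyIntegrable
  · refine closure_minimal ?_ isClosed_cthickening
    refine (support_convolution_subset L).trans ?_
    rw [ContDiffBump.support_normed_eq]
    rintro _ ⟨y, hy, z, hz, rfl⟩
    refine mem_cthickening_of_dist_le _ z δ _ (subset_tsupport _ hz) ?_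
    simp only [mem_ball, dist_zero_right] at hy
    simpa [dist_eq_norm] using hy.le.trans (hρδ n)
  · exact (norm_normed_convolution_le (ρ n) hφ.continuous hφc hM₁ x).trans (le_max_left _ _)
  · rw [hder]
    exact (norm_normed_convolution_le (ρ n) hdc (hφc.fderiv (𝕜 := ℝ)) hM₂ x).trans
      (le_max_right _ _)
  · exact ContDiffBump.convolution_tendsto_right_of_continuous hρ0 hφ.continuous x
  · simp_rw [hder]
    exact ContDiffBump.convolution_tendsto_right_of_continuous hρ0 hdc x

theorem integral_fderiv_eq_of_contDiff_one {Ω : Set E} (hΩ : IsOpen Ω) {F : E → E} {g : E → ℝ}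
    (hF : ContinuousOn F Ω) (hg : ContinuousOn g Ω)
    (hweak : ∀ ψ : E → ℝ, ContDiff ℝ (⊤ : ℕ∞) ψ → HasCompactSupport ψ → tsupport ψ ⊆ Ω →
      ∫ x in Ω, fderiv ℝ ψ x (F x) ∂μ = ∫ x in Ω, g x * ψ x ∂μ)
    {φ : E → ℝ} (hφ : ContDiff ℝ 1 φ) (hφc : HasCompactSupport φ) (hφΩ : tsupport φ ⊆ Ω) :
    ∫ x in Ω, fderiv ℝ φ x (F x) ∂μ = ∫ x in Ω, g x * φ x ∂μ := by
  obtain ⟨K, M, ψ, hK, hKΩ, hψ, hψK, hb, hdb, ht, hdt⟩ :=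
    exists_smooth_approx hΩ hφ hφc hφΩ
  have hint : ∀ f : E → ℝ, ContinuousOn f Ω →
      Integrable (K.indicator fun x => M * |f x|) (μ.restrict Ω) := fun f hf =>
    (((((hf.mono hKΩ).abs.const_mul M).integrableOn_compact hK).integrable_indicator
      hK.measurableSet)).restrict
  have hout : ∀ n x, x ∉ K → ψ n x = 0 ∧ fderiv ℝ (ψ n) x = 0 := fun n x hx =>
    ⟨image_eq_zero_of_notMem_tsupport fun h => hx (hψK n h),
      image_eq_zero_of_notMem_tsupport fun h => hx (hψK n (tsupport_fderiv_subset ℝ h))⟩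
  have h1 : Tendsto (fun n => ∫ x in Ω, fderiv ℝ (ψ n) x (F x) ∂μ) atTop
      (𝓝 (∫ x in Ω, fderiv ℝ φ x (F x) ∂μ)) := by
    refine tendsto_integral_of_dominated_convergence (K.indicator fun x => M * |‖F x‖|)
      (fun n => ?_) (hint _ hF.norm) (fun n => ?_) ?_
    · exact ContinuousOn.aestronglyMeasurable
        ((((hψ n).continuous_fderiv (by simp)).continuousOn).clm_apply hF) hΩ.measurableSet
    · refine ae_of_all _ fun x => ?_
      by_cases hx : x ∈ K
      · rw [Set.indicator_of_mem hx, abs_norm]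
        exact ((fderiv ℝ (ψ n) x).le_opNorm _).trans
          (mul_le_mul_of_nonneg_right (hdb n x) (norm_nonneg _))
      · simp [Set.indicator_of_notMem hx, (hout n x hx).2]
    · exact ae_of_all _ fun x =>
        ((ContinuousLinearMap.apply ℝ ℝ (F x)).continuous.tendsto _).comp (hdt x)
  have h2 : Tendsto (fun n => ∫ x in Ω, g x * ψ n x ∂μ) atTop
      (𝓝 (∫ x in Ω, g x * φ x ∂μ)) := by
    refine tendsto_integral_of_dominated_convergence (K.indicator fun x => M * |g x|)
      (fun n => ?_) (hint _ hg) (fun n => ?_) ?_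
    · exact ContinuousOn.aestronglyMeasurable
        (hg.mul (hψ n).continuous.continuousOn) hΩ.measurableSet
    · refine ae_of_all _ fun x => ?_
      by_cases hx : x ∈ K
      · rw [Set.indicator_of_mem hx, norm_mul, mul_comm]
        exact mul_le_mul_of_nonneg_right (hb n x) (abs_nonneg _)
      · simp [Set.indicator_of_notMem hx, (hout n x hx).1]
    · exact ae_of_all _ fun x => (ht x).const_mul _
  refine tendsto_nhds_unique h1 (h2.congr fun n => ?_)
  exact (hweak _ (hψ n) (hK.of_isClosed_subset (isClosed_tsupport _) (hψK n))
    ((hψK n).trans hKΩ)).symm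

/-- A weak identity tested against smooth functions extends to functions which are `C¹` in `Ω`
and vanish off a compact subset of `Ω`. -/
theorem integral_fderiv_eq_of_hasFDerivAt {Ω K : Set E} (hΩ : IsOpen Ω) (hK : IsCompact K)
    (hKΩ : K ⊆ Ω) {F : E → E} {g : E → ℝ}
    (hF : ContinuousOn F Ω) (hg : ContinuousOn g Ω)
    (hweak : ∀ ψ : E → ℝ, ContDiff ℝ (⊤ : ℕ∞) ψ → HasCompactSupport ψ → tsupport ψ ⊆ Ω →
      ∫ x in Ω, fderiv ℝ ψ x (F x) ∂μ = ∫ x in Ω, g x * ψ x ∂μ)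
    {φ : E → ℝ} {φ' : E → E →L[ℝ] ℝ} (hφ : ∀ x ∈ Ω, HasFDerivAt φ (φ' x) x)
    (hφ' : ContinuousOn φ' Ω) (h0 : ∀ x ∈ Ω, x ∉ K → φ x = 0) :
    IntegrableOn (fun x => φ' x (F x)) Ω μ ∧ IntegrableOn (fun x => g x * φ x) Ω μ ∧
      ∫ x in Ω, φ' x (F x) ∂μ = ∫ x in Ω, g x * φ x ∂μ := by
  obtain ⟨hC, hs⟩ := contDiff_one_indicator hΩ hK hKΩ hφ hφ' h0
  have hφc : ContinuousOn φ Ω := fun x hx => (hφ x hx).continuousAt.continuousWithinAt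
  have hφ'0 : ∀ x ∈ Ω, x ∉ K → φ' x = 0 := fun x hx hxK => by
    refine (hφ x hx).unique ((hasFDerivAt_const (0 : ℝ) x).congr_of_eventuallyEq ?_)
    filter_upwards [hΩ.mem_nhds hx, hK.isClosed.isOpen_compl.mem_nhds hxK] with z hz hzK
      using h0 z hz hzK
  have hint : ∀ f : E → ℝ, ContinuousOn f Ω → (∀ x ∈ Ω, x ∉ K → f x = 0) →
      IntegrableOn f Ω μ := fun f hf hf0 =>
    ((hf.mono hKΩ).integrableOn_compact hK).of_forall_sdiff_eq_zero hΩ.measurableSet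
      fun x hx => hf0 x hx.1 hx.2
  refine ⟨hint _ (hφ'.clm_apply hF) fun x hx hxK => by simp [hφ'0 x hx hxK],
    hint _ (hg.mul hφc) fun x hx hxK => by simp [h0 x hx hxK], ?_⟩
  have h := integral_fderiv_eq_of_contDiff_one hΩ hF hg hweak hC
    (hK.of_isClosed_subset (isClosed_tsupport _) hs) (hs.trans hKΩ)
  have h1 : ∫ x in Ω, fderiv ℝ (Ω.indicator φ) x (F x) ∂μ = ∫ x in Ω, φ' x (F x) ∂μ :=
    setIntegral_congr_fun hΩ.measurableSet fun x hx => by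
      have : HasFDerivAt (Ω.indicator φ) (φ' x) x := by
        refine (hφ x hx).congr_of_eventuallyEq ?_
        filter_upwards [hΩ.mem_nhds hx] with z hz using Set.indicator_of_mem hz φ
      simp [this.fderiv]
  have h2 : ∫ x in Ω, g x * Ω.indicator φ x ∂μ = ∫ x in Ω, g x * φ x ∂μ :=
    setIntegral_congr_fun hΩ.measurableSet fun x hx => by simp [Set.indicator_of_mem hx]
  rw [← h1, h, h2]

end WeakFormulation

section Inequalities

/-- A `C¹` soft threshold: it vanishes on `[-δ, δ]` and stays within `2 * δ` of the identity. -/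
theorem exists_soft_threshold {δ : ℝ} (hδ : 0 < δ) :
    ∃ T τ : ℝ → ℝ, Continuous τ ∧ (∀ s, HasDerivAt T (τ s) s) ∧ (∀ s, 0 ≤ τ s) ∧
      (∀ s, |s| ≤ δ → T s = 0) ∧ (∀ s, 0 ≤ s → 0 ≤ T s) ∧ (∀ s, |T s - s| ≤ 2 * δ) ∧
      ∀ s, |s * τ s - T s| ≤ 2 * δ := by
  set τ : ℝ → ℝ := fun s => min 1 (max 0 (|s| / δ - 1)) with hτ
  have hτc : Continuous τ := by fun_prop
  have hτ0 : ∀ s, 0 ≤ τ s := fun s => le_min zero_le_one (le_max_left _ _)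
  have hτ1 : ∀ s, τ s ≤ 1 := fun s => min_le_left _ _
  have hτeven : ∀ s, τ (-s) = τ s := fun s => by simp [hτ]
  have hτδ : ∀ s, |s| ≤ δ → τ s = 0 := fun s hs => by
    have : |s| / δ - 1 ≤ 0 := by rw [sub_nonpos, div_le_one hδ]; exact hs
    simp [hτ, max_eq_left this]
  have hτ2 : ∀ s, 2 * δ ≤ s → τ s = 1 := fun s hs => by
    have : 1 ≤ |s| / δ - 1 := by
      rw [le_sub_iff_add_le, le_div_iff₀ hδ]
      linarith [le_abs_self s]
    simp [hτ, this]
  have hi : ∀ a b, IntervalIntegrable τ volume a b := fun a b => hτc.intervalIntegrable a b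
  set T : ℝ → ℝ := fun s => ∫ t in (0 : ℝ)..s, τ t with hT
  have hTodd : ∀ s, T (-s) = -T s := fun s => by
    have := intervalIntegral.integral_comp_neg (a := 0) (b := s) τ
    simp only [hτeven, neg_zero] at this
    rw [hT]
    change (∫ t in (0 : ℝ)..(-s), τ t) = -∫ t in (0 : ℝ)..s, τ t
    rw [this, intervalIntegral.integral_symm]
  have hTnn : ∀ s, 0 ≤ s → 0 ≤ T s := fun s hs =>
    intervalIntegral.integral_nonneg hs fun t _ => hτ0 t
  have hTle : ∀ s, 0 ≤ s → T s ≤ s := fun s hs => by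
    have := intervalIntegral.integral_mono_on hs (hi 0 s) intervalIntegrable_const
      (g := fun _ => (1 : ℝ)) fun t _ => hτ1 t
    simpa using this
  have hTge : ∀ s, 0 ≤ s → s - 2 * δ ≤ T s := fun s hs => by
    rcases le_total s (2 * δ) with h | h
    · linarith [hTnn s hs]
    · have h1 : T s = T (2 * δ) + ∫ t in (2 * δ)..s, τ t :=
        (intervalIntegral.integral_add_adjacent_intervals (hi _ _) (hi _ _)).symm
      have h2 : ∫ t in (2 * δ)..s, τ t = ∫ t in (2 * δ)..s, (1 : ℝ) :=
        intervalIntegral.integral_congr fun t ht => by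
          rw [Set.uIcc_of_le h] at ht
          exact hτ2 t ht.1
      rw [h1, h2, intervalIntegral.integral_const, smul_eq_mul, mul_one]
      linarith [hTnn (2 * δ) (by positivity)]
  have hT0 : ∀ s, 0 ≤ s → s ≤ δ → T s = 0 := fun s hs h => by
    have : T s = ∫ t in (0 : ℝ)..s, (0 : ℝ) :=
      intervalIntegral.integral_congr fun t ht => by
        rw [Set.uIcc_of_le hs] at ht
        exact hτδ t (by rw [abs_of_nonneg ht.1]; exact ht.2.trans h)
    simpa using this
  have hmul : ∀ s, 0 ≤ s → |s * τ s - T s| ≤ 2 * δ := fun s hs => by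
    rcases le_total s (2 * δ) with h | h
    · have h1 : s * τ s ≤ s := mul_le_of_le_one_right hs (hτ1 s)
      have h2 : 0 ≤ s * τ s := mul_nonneg hs (hτ0 s)
      rw [abs_le]
      constructor <;> linarith [hTnn s hs, hTle s hs]
    · rw [hτ2 s h, mul_one, abs_le]
      constructor <;> linarith [hTge s hs, hTle s hs]
  refine ⟨T, τ, hτc, fun s => (hτc.integral_hasStrictDerivAt 0 s).hasDerivAt, hτ0, fun s hs => ?_,
    hTnn, fun s => ?_, fun s => ?_⟩
  · rcases le_total 0 s with h | h
    · exact hT0 s h ((le_abs_self s).trans hs)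
    · have := hT0 (-s) (by linarith) ((neg_le_abs s).trans hs)
      rw [hTodd] at this
      linarith
  · rcases le_total 0 s with h | h
    · rw [abs_le]
      constructor <;> linarith [hTge s h, hTle s h]
    · have h1 := hTge (-s) (by linarith)
      have h2 := hTle (-s) (by linarith)
      rw [hTodd] at h1 h2
      rw [abs_le]
      constructor <;> linarith
  · rcases le_total 0 s with h | h
    · exact hmul s h
    · have h1 := hmul (-s) (by linarith)
      rw [hTodd, hτeven] at h1
      rw [abs_sub_comm]
      convert h1 using 2
      ring

theorem young_rpow_sub_one {q A y : ℝ} (hq : 1 < q) (hA : 0 ≤ A) (hy : 0 ≤ y) :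
    q * A ^ (q - 1) * y ≤ y ^ q + (q - 1) * A ^ q := by
  have h := Real.young_inequality_of_nonneg hy (Real.rpow_nonneg hA (q - 1))
    (Real.HolderConjugate.conjExponent hq)
  rw [← Real.rpow_mul hA, Real.conjExponent, mul_div_cancel₀ _ (by linarith : q - 1 ≠ 0)] at h
  have hq0 : 0 < q := by linarith
  have h' := mul_le_mul_of_nonneg_left h hq0.le
  have e : q * (y ^ q / q + A ^ q / (q / (q - 1))) = y ^ q + (q - 1) * A ^ q := by
    field_simp
  linarith

theorem young_weighted {p q r x y : ℝ} (hq : 1 < q) (hqp : q < p) (hr : 0 ≤ r) (hx : 0 ≤ x)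
    (hy : 0 ≤ y) :
    q * r ^ (q - 1) * (x ^ (p - 1) * y) ≤ x ^ (p - q) * y ^ q + (q - 1) * r ^ q * x ^ p := by
  have h := mul_le_mul_of_nonneg_left (young_rpow_sub_one hq (mul_nonneg hr hx) hy)
    (Real.rpow_nonneg hx (p - q))
  have e1 : x ^ (p - 1) = x ^ (p - q) * x ^ (q - 1) := by
    rw [← Real.rpow_add_of_nonneg hx (by linarith) (by linarith)]
    ring_nf
  have e2 : x ^ p = x ^ (p - q) * x ^ q := by
    rw [← Real.rpow_add_of_nonneg hx (by linarith) (by linarith)]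
    ring_nf
  rw [Real.mul_rpow hr hx, Real.mul_rpow hr hx] at h
  rw [e1, e2]
  linarith

theorem rpow_sub_mul_rpow_sub_nonneg {x y s t : ℝ} (hs : 0 ≤ s) (ht : 0 ≤ t) (hx : 0 ≤ x)
    (hy : 0 ≤ y) : 0 ≤ (x ^ s - y ^ s) * (x ^ t - y ^ t) := by
  rcases le_total x y with h | h
  · exact mul_nonneg_of_nonpos_of_nonpos (sub_nonpos.2 (Real.rpow_le_rpow hx h hs))
      (sub_nonpos.2 (Real.rpow_le_rpow hx h ht))
  · exact mul_nonneg (sub_nonneg.2 (Real.rpow_le_rpow hy h hs))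
      (sub_nonneg.2 (Real.rpow_le_rpow hy h ht))

theorem rpow_sub_two_mul_sq {p x : ℝ} (hp : 1 < p) (hx : 0 ≤ x) : x ^ (p - 2) * x ^ 2 = x ^ p := by
  rcases hx.eq_or_lt with rfl | hx
  · simp [Real.zero_rpow (show p ≠ 0 by linarith)]
  · rw [← Real.rpow_natCast, ← Real.rpow_add hx]
    norm_num

theorem rpow_sub_two_mul_self {p x : ℝ} (hp : 1 < p) (hx : 0 ≤ x) :
    x ^ (p - 2) * x = x ^ (p - 1) := by
  rcases hx.eq_or_lt with rfl | hx
  · simp [Real.zero_rpow (show p - 1 ≠ 0 by linarith)]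
  · nth_rewrite 2 [← Real.rpow_one x]
    rw [← Real.rpow_add hx]
    ring_nf

variable {E : Type*} [NormedAddCommGroup E] [InnerProductSpace ℝ E]

theorem picone_half {p q U V : ℝ} (hq : 1 < q) (hqp : q < p) (hU : 0 < U) (hV : 0 < V) (X Y : E) :
    ‖X‖ ^ p - ‖X‖ ^ (p - q) * ‖Y‖ ^ q ≤
      ‖X‖ ^ (p - 2) * ((q * U ^ (q - 1) * ‖X‖ ^ 2 - q * V ^ (q - 1) * ⟪Y, X⟫) * U ^ (1 - q)
        + (U ^ q - V ^ q) * ((1 - q) * U ^ (-q)) * ‖X‖ ^ 2) := by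
  have hp : 1 < p := hq.trans hqp
  have h := young_weighted hq hqp (div_pos hV hU).le (norm_nonneg X) (norm_nonneg Y)
  have e1 : (V / U) ^ (q - 1) = V ^ (q - 1) * U ^ (1 - q) := by
    rw [Real.div_rpow hV.le hU.le, show (1 - q) = -(q - 1) by ring, Real.rpow_neg hU.le]
    rfl
  have e2 : (V / U) ^ q = V ^ q * U ^ (-q) := by
    rw [Real.div_rpow hV.le hU.le, Real.rpow_neg hU.le]
    rfl
  have e3 : U ^ (q - 1) * U ^ (1 - q) = 1 := by rw [← Real.rpow_add hU]; simp
  have e4 : U ^ q * U ^ (-q) = 1 := by rw [← Real.rpow_add hU]; simp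
  have e5 := rpow_sub_two_mul_sq hp (norm_nonneg X)
  have e6 := rpow_sub_two_mul_self hp (norm_nonneg X)
  have hin : ‖X‖ ^ (p - 2) * ⟪Y, X⟫ ≤ ‖X‖ ^ (p - 1) * ‖Y‖ := by
    rw [← e6, mul_assoc, mul_comm ‖X‖ ‖Y‖]
    exact mul_le_mul_of_nonneg_left (real_inner_le_norm Y X) (by positivity)
  have hc : 0 ≤ q * (V ^ (q - 1) * U ^ (1 - q)) := by positivity
  have h2 := mul_le_mul_of_nonneg_left hin hc
  rw [e1, e2] at h
  have key : ‖X‖ ^ (p - 2) * ((q * U ^ (q - 1) * ‖X‖ ^ 2 - q * V ^ (q - 1) * ⟪Y, X⟫) * U ^ (1 - q)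
        + (U ^ q - V ^ q) * ((1 - q) * U ^ (-q)) * ‖X‖ ^ 2)
      = q * (U ^ (q - 1) * U ^ (1 - q)) * (‖X‖ ^ (p - 2) * ‖X‖ ^ 2)
        - q * (V ^ (q - 1) * U ^ (1 - q)) * (‖X‖ ^ (p - 2) * ⟪Y, X⟫)
        + (1 - q) * (U ^ q * U ^ (-q)) * (‖X‖ ^ (p - 2) * ‖X‖ ^ 2)
        + (q - 1) * (V ^ q * U ^ (-q)) * (‖X‖ ^ (p - 2) * ‖X‖ ^ 2) := by ring
  rw [key, e3, e4, e5]
  linarith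

/-- A quantitative form of the Picone (Díaz–Saá) inequality for the truncated test pair
`T (U ^ q - V ^ q) * U ^ (1 - q)` and `-T (U ^ q - V ^ q) * V ^ (1 - q)`, where `T` and `T'`
stand for the values of the truncation and of its derivative. -/
theorem picone_truncated {p q U V ε κ T T' : ℝ} (hq : 1 < q) (hqp : q < p) (hε : 0 < ε)
    (hU : ε ≤ U) (hV : ε ≤ V) (hT' : 0 ≤ T') (hT : |(U ^ q - V ^ q) * T' - T| ≤ κ) (X Y : E) :
    -(κ * ((q - 1) * ε ^ (-q) * (‖X‖ ^ p + ‖Y‖ ^ p))) ≤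
      ‖X‖ ^ (p - 2) * (T' * (q * U ^ (q - 1) * ‖X‖ ^ 2 - q * V ^ (q - 1) * ⟪Y, X⟫) * U ^ (1 - q)
        + T * ((1 - q) * U ^ (-q)) * ‖X‖ ^ 2) -
      ‖Y‖ ^ (p - 2) * (T' * (q * U ^ (q - 1) * ⟪X, Y⟫ - q * V ^ (q - 1) * ‖Y‖ ^ 2) * V ^ (1 - q)
        + T * ((1 - q) * V ^ (-q)) * ‖Y‖ ^ 2) := by
  have hp : 1 < p := hq.trans hqp
  have hU0 := hε.trans_le hU
  have hV0 := hε.trans_le hV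
  have h1 := picone_half hq hqp hU0 hV0 X Y
  have h2 := picone_half hq hqp hV0 hU0 Y X
  have e5 := rpow_sub_two_mul_sq hp (norm_nonneg X)
  have e6 := rpow_sub_two_mul_sq hp (norm_nonneg Y)
  have h3 := rpow_sub_mul_rpow_sub_nonneg (sub_nonneg.2 hqp.le) (by linarith : 0 ≤ q)
    (norm_nonneg X) (norm_nonneg Y)
  have s1 : ‖X‖ ^ (p - q) * ‖X‖ ^ q = ‖X‖ ^ p := by
    rw [← Real.rpow_add_of_nonneg (norm_nonneg X) (by linarith) (by linarith)]; ring_nf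
  have s2 : ‖Y‖ ^ (p - q) * ‖Y‖ ^ q = ‖Y‖ ^ p := by
    rw [← Real.rpow_add_of_nonneg (norm_nonneg Y) (by linarith) (by linarith)]; ring_nf
  have h4 := mul_nonneg hT' (by linarith : (0 : ℝ) ≤
      ‖X‖ ^ (p - 2) * ((q * U ^ (q - 1) * ‖X‖ ^ 2 - q * V ^ (q - 1) * ⟪Y, X⟫) * U ^ (1 - q)
        + (U ^ q - V ^ q) * ((1 - q) * U ^ (-q)) * ‖X‖ ^ 2) +
      ‖Y‖ ^ (p - 2) * ((q * V ^ (q - 1) * ‖Y‖ ^ 2 - q * U ^ (q - 1) * ⟪X, Y⟫) * V ^ (1 - q)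
        + (V ^ q - U ^ q) * ((1 - q) * V ^ (-q)) * ‖Y‖ ^ 2))
  have hB : |(q - 1) * (U ^ (-q) * ‖X‖ ^ p - V ^ (-q) * ‖Y‖ ^ p)|
      ≤ (q - 1) * ε ^ (-q) * (‖X‖ ^ p + ‖Y‖ ^ p) := by
    have b1 : U ^ (-q) * ‖X‖ ^ p ≤ ε ^ (-q) * ‖X‖ ^ p :=
      mul_le_mul_of_nonneg_right (Real.rpow_le_rpow_of_nonpos hε hU (by linarith)) (by positivity)
    have b2 : V ^ (-q) * ‖Y‖ ^ p ≤ ε ^ (-q) * ‖Y‖ ^ p :=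
      mul_le_mul_of_nonneg_right (Real.rpow_le_rpow_of_nonpos hε hV (by linarith)) (by positivity)
    have b3 : 0 ≤ U ^ (-q) * ‖X‖ ^ p := by positivity
    have b4 : 0 ≤ V ^ (-q) * ‖Y‖ ^ p := by positivity
    rw [abs_mul, abs_of_pos (by linarith : 0 < q - 1), mul_assoc]
    refine mul_le_mul_of_nonneg_left ?_ (by linarith)
    rw [abs_le]
    constructor <;> linarith
  have hκ := mul_le_mul hT hB (abs_nonneg _) ((abs_nonneg _).trans hT)
  rw [← abs_mul] at hκ
  have h5 := (abs_le.1 hκ).1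
  rw [← e5, ← e6] at h5 ⊢
  linarith

end Inequalities

section SetLemmas

variable {X : Type*} [PseudoMetricSpace X] {Ω : Set X} {f : X → ℝ} {δ : ℝ}

theorem isCompact_superlevel [ProperSpace X] (hΩb : Bornology.IsBounded Ω)
    (hf : ContinuousOn f (closure Ω)) : IsCompact {x | x ∈ closure Ω ∧ δ ≤ |f x|} :=
  hΩb.isCompact_closure.of_isClosed_subset
    (hf.abs.preimage_isClosed_of_isClosed isClosed_closure isClosed_Ici) fun _ hx => hx.1

theorem superlevel_subset (hΩ : IsOpen Ω) (hf0 : ∀ x ∈ frontier Ω, f x = 0) (hδ : 0 < δ) :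
    {x | x ∈ closure Ω ∧ δ ≤ |f x|} ⊆ Ω := fun x hx => by
  by_contra h
  have h1 := hx.2
  rw [hf0 x (hΩ.frontier_eq ▸ ⟨hx.1, h⟩), abs_zero] at h1
  exact h1.not_gt hδ

theorem eqOn_zero_of_integral_nonneg [MeasurableSpace X] [BorelSpace X] {μ : Measure X}
    [μ.IsOpenPosMeasure] (hΩ : IsOpen Ω) (hf : ContinuousOn f Ω) (hle : ∀ x ∈ Ω, f x ≤ 0)
    (hi : IntegrableOn f Ω μ) (h : 0 ≤ ∫ x in Ω, f x ∂μ) : ∀ x ∈ Ω, f x = 0 := by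
  have hle' : ∀ᵐ x ∂μ.restrict Ω, 0 ≤ -f x :=
    (ae_restrict_iff' hΩ.measurableSet).2 (ae_of_all _ fun x hx => neg_nonneg.2 (hle x hx))
  have h0 : ∫ x in Ω, -f x ∂μ = 0 := by
    refine le_antisymm ?_ (integral_nonneg_of_ae hle')
    rw [integral_neg]
    linarith
  have hae : f =ᵐ[μ.restrict Ω] fun _ => 0 := by
    filter_upwards [(integral_eq_zero_iff_of_nonneg_ae hle' hi.neg).1 h0] with x hx
    simpa using hx
  exact Measure.eqOn_open_of_ae_eq hae hΩ hf continuousOn_const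

end SetLemmas

namespace DirichletSol

open Filter Topology Metric

variable {N : ℕ} {Ω K : Set (EuclideanSpace ℝ (Fin N))} {p q lam : ℝ}
  {a u : EuclideanSpace ℝ (Fin N) → ℝ}

theorem hasFDerivAt (hu : DirichletSol Ω p q lam a u) {x : EuclideanSpace ℝ (Fin N)} (hx : x ∈ Ω) :
    HasFDerivAt u (fderiv ℝ u x) x :=
  (hu.2.1 x hx).hasFDerivAt

theorem continuousOn_fderiv (hu : DirichletSol Ω p q lam a u) :
    ContinuousOn (fderiv ℝ u) Ω := by
  rw [← toDual_comp_gradient]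
  exact (InnerProductSpace.toDual ℝ _).continuous.comp_continuousOn hu.2.2.1

theorem continuousOn (hu : DirichletSol Ω p q lam a u) : ContinuousOn u Ω :=
  hu.1.mono subset_closure

theorem nonneg (hu : DirichletSol Ω p q lam a u) {x : EuclideanSpace ℝ (Fin N)} (hx : x ∈ Ω) :
    0 ≤ u x :=
  hu.2.2.2.1 x hx

theorem continuousOn_rhs (hu : DirichletSol Ω p q lam a u) (hp : 1 < p) (hq : 1 < q)
    (ha : ContinuousOn a Ω) :
    ContinuousOn (fun x => lam * u x ^ (p - 1) + a x * u x ^ (q - 1)) Ω :=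
  ((hu.continuousOn.rpow_const fun _ _ => Or.inr (by linarith)).const_mul lam).add
    (ha.mul (hu.continuousOn.rpow_const fun _ _ => Or.inr (by linarith)))

/-- The weak formulation may be tested with any function which is `C¹` in `Ω` and vanishes off a
compact subset of `Ω`. -/
theorem weak_identity (hu : DirichletSol Ω p q lam a u) (hΩ : IsOpen Ω) (hp : 1 < p) (hq : 1 < q)
    (ha : ContinuousOn a Ω) (hK : IsCompact K) (hKΩ : K ⊆ Ω) {φ : EuclideanSpace ℝ (Fin N) → ℝ}
    {φ' : EuclideanSpace ℝ (Fin N) → EuclideanSpace ℝ (Fin N) →L[ℝ] ℝ}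
    (hφ : ∀ x ∈ Ω, HasFDerivAt φ (φ' x) x)
    (hφ' : ContinuousOn φ' Ω) (h0 : ∀ x ∈ Ω, x ∉ K → φ x = 0) :
    IntegrableOn (fun x => ‖gradient u x‖ ^ (p - 2) * φ' x (gradient u x)) Ω ∧
      IntegrableOn (fun x => (lam * u x ^ (p - 1) + a x * u x ^ (q - 1)) * φ x) Ω ∧
      ∫ x in Ω, ‖gradient u x‖ ^ (p - 2) * φ' x (gradient u x)
        = ∫ x in Ω, (lam * u x ^ (p - 1) + a x * u x ^ (q - 1)) * φ x := by
  have h := integral_fderiv_eq_of_hasFDerivAt (μ := volume) hΩ hK hKΩ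
    (F := fun x => ‖gradient u x‖ ^ (p - 2) • gradient u x)
    ((continuous_rpow_norm_smul hp).comp_continuousOn hu.2.2.1)
    (hu.continuousOn_rhs hp hq ha) (fun ψ h1 h2 h3 => ?_) hφ hφ' h0
  · simpa only [map_smul, smul_eq_mul] using h
  · simpa only [map_smul, smul_eq_mul, inner_gradient_right, conj_trivial]
      using hu.2.2.2.2.2.2 ψ ⟨h1, h2, h3⟩

/-- A nontrivial solution cannot vanish identically where the weight is positive. -/
theorem exists_pos_of_nontrivial (hu : DirichletSol Ω p q lam a u) (hΩ : IsOpen Ω)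
    (hΩb : Bornology.IsBounded Ω) (hp : 1 < p) (hq : 1 < q) (ha : ContinuousOn a Ω)
    (hlam : lam < 0) (hnt : ∃ x ∈ Ω, u x ≠ 0) : ∃ x ∈ Ω, 0 < a x ∧ u x ≠ 0 := by
  by_contra! hcon
  obtain ⟨x₀, hx₀, hne⟩ := hnt
  have hpos : 0 < u x₀ := (hu.nonneg hx₀).lt_of_ne hne.symm
  obtain ⟨T, τ, hτc, hTd, hτ0, hT0, hTnn, hTs, -⟩ :=
    exists_soft_threshold (δ := u x₀ / 4) (by positivity)
  obtain ⟨-, hi, h⟩ := hu.weak_identity hΩ hp hq ha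
    (isCompact_superlevel hΩb hu.1 (δ := u x₀ / 4))
    (superlevel_subset hΩ hu.2.2.2.2.1 (by positivity))
    (φ := fun x => T (u x)) (φ' := fun x => τ (u x) • fderiv ℝ u x)
    (fun x hx => (hTd (u x)).comp_hasFDerivAt x (hu.hasFDerivAt hx))
    ((hτc.comp_continuousOn hu.continuousOn).smul hu.continuousOn_fderiv)
    (fun x hx hxK => hT0 _ (not_lt.1 fun h => hxK ⟨subset_closure hx, h.le⟩))
  have hl : 0 ≤ ∫ x in Ω, ‖gradient u x‖ ^ (p - 2) *
      (τ (u x) • fderiv ℝ u x) (gradient u x) := by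
    refine integral_nonneg fun x => ?_
    simp only [smul_apply, smul_eq_mul, ← inner_gradient_left,
      real_inner_self_eq_norm_sq, Pi.zero_apply]
    have := hτ0 (u x)
    positivity
  have hr : ∀ x ∈ Ω, (lam * u x ^ (p - 1) + a x * u x ^ (q - 1)) * T (u x)
      ≤ lam * u x ^ (p - 1) * T (u x) := fun x hx => by
    refine mul_le_mul_of_nonneg_right ?_ (hTnn _ (hu.nonneg hx))
    have h1 : a x * u x ^ (q - 1) ≤ 0 := by
      rcases le_or_gt (a x) 0 with h | h
      · exact mul_nonpos_of_nonpos_of_nonneg h (Real.rpow_nonneg (hu.nonneg hx) _)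
      · rw [hcon x hx h, Real.zero_rpow (by linarith), mul_zero]
    linarith
  have hr' : ∀ x ∈ Ω, lam * u x ^ (p - 1) * T (u x) ≤ 0 := fun x hx =>
    mul_nonpos_of_nonpos_of_nonneg (mul_nonpos_of_nonpos_of_nonneg hlam.le
      (Real.rpow_nonneg (hu.nonneg hx) _)) (hTnn _ (hu.nonneg hx))
  set g : EuclideanSpace ℝ (Fin N) → ℝ :=
    fun x => (lam * u x ^ (p - 1) + a x * u x ^ (q - 1)) * T (u x) with hg
  have hgc : ContinuousOn g Ω := (hu.continuousOn_rhs hp hq ha).mul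
    ((continuous_iff_continuousAt.2 fun s => (hTd s).continuousAt).comp_continuousOn
      hu.continuousOn)
  have hlt : g x₀ < 0 := by
    refine (hr x₀ hx₀).trans_lt (mul_neg_of_neg_of_pos
      (mul_neg_of_neg_of_pos hlam (Real.rpow_pos_of_pos hpos _)) ?_)
    have := (abs_le.1 (hTs (u x₀))).1
    linarith
  have hgle : ∀ x ∈ Ω, g x ≤ 0 := fun x hx => (hr x hx).trans (hr' x hx)
  rw [h] at hl
  exact hlt.ne (eqOn_zero_of_integral_nonneg hΩ hgc hgle hi hl x₀ hx₀)

end DirichletSol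

section LogEstimate

theorem exists_young_const {p : ℝ} (hp : 1 < p) : ∃ C : ℝ, ∀ s t : ℝ, 0 ≤ s → 0 ≤ t →
    p * s ^ (p - 1) * t ≤ (p - 1) / 2 * s ^ p + C * t ^ p := by
  set κ : ℝ := (p - 1) / (2 * p) with hκ
  have hκ0 : 0 < κ := div_pos (by linarith) (by linarith)
  refine ⟨p * (κ ^ (p - 1))⁻¹, fun s t hs ht => ?_⟩
  have hp0 : 0 < p := by linarith
  have hs' : s ^ (p - 1) * s = s ^ p := by
    nth_rewrite 2 [← Real.rpow_one s]
    rw [← Real.rpow_add_of_nonneg hs (by linarith) zero_le_one]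
    ring_nf
  have ht' : t ^ (p - 1) * t = t ^ p := by
    nth_rewrite 2 [← Real.rpow_one t]
    rw [← Real.rpow_add_of_nonneg ht (by linarith) zero_le_one]
    ring_nf
  rcases le_total t (κ * s) with h | h
  · have h1 : p * s ^ (p - 1) * t ≤ p * s ^ (p - 1) * (κ * s) :=
      mul_le_mul_of_nonneg_left h (by positivity)
    have h2 : p * s ^ (p - 1) * (κ * s) = (p - 1) / 2 * s ^ p := by
      rw [← hs', hκ]
      field_simp
    have h3 : 0 ≤ p * (κ ^ (p - 1))⁻¹ * t ^ p := by positivity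
    linarith
  · have h1 : s ^ (p - 1) ≤ (κ ^ (p - 1))⁻¹ * t ^ (p - 1) := by
      rw [inv_mul_eq_div, ← Real.div_rpow ht hκ0.le]
      exact Real.rpow_le_rpow hs ((le_div_iff₀' hκ0).2 h) (by linarith)
    have h2 : p * s ^ (p - 1) * t ≤ p * ((κ ^ (p - 1))⁻¹ * t ^ (p - 1)) * t := by gcongr
    have h3 : 0 ≤ (p - 1) / 2 * s ^ p := mul_nonneg (by linarith) (by positivity)
    have h4 : p * ((κ ^ (p - 1))⁻¹ * t ^ (p - 1)) * t = p * (κ ^ (p - 1))⁻¹ * t ^ p := by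
      rw [← ht']
      ring
    linarith

/-- Caccioppoli inequality for `log (u + ε)` on the region where the weight is nonnegative. -/
theorem DirichletSol.exists_log_gradient_bound {N : ℕ} {Ω : Set (EuclideanSpace ℝ (Fin N))}
    {p q lam : ℝ} {a u : EuclideanSpace ℝ (Fin N) → ℝ}
    (hu : DirichletSol Ω p q lam a u) (hΩ : IsOpen Ω) (hp : 1 < p) (hq : 1 < q)
    (ha : ContinuousOn a Ω) (hlam : lam < 0) {η : EuclideanSpace ℝ (Fin N) → ℝ}
    (hη : ContDiff ℝ 1 η) (hηc : HasCompactSupport η) (hηΩ : tsupport η ⊆ Ω) (hη0 : ∀ x, 0 ≤ η x)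
    (haη : ∀ x ∈ tsupport η, 0 ≤ a x) :
    ∃ C : ℝ, ∀ ε : ℝ, 0 < ε →
      IntegrableOn (fun x => (η x * ‖gradient u x‖ / (u x + ε)) ^ p) Ω ∧
      ∫ x in Ω, (η x * ‖gradient u x‖ / (u x + ε)) ^ p ≤ C := by
  obtain ⟨C₁, hC₁⟩ := exists_young_const hp
  have hηd : Continuous (fderiv ℝ η) := hη.continuous_fderiv one_ne_zero
  have hi1 : IntegrableOn (fun x => C₁ * ‖fderiv ℝ η x‖ ^ p) Ω := by
    refine (Continuous.integrable_of_hasCompactSupport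
      (hηd.norm.rpow_const fun _ => Or.inr (by linarith)) ?_).integrableOn.const_mul C₁
    exact (hηc.fderiv (𝕜 := ℝ)).comp_left (g := fun y => ‖y‖ ^ p)
      (by simp [Real.zero_rpow (by linarith : p ≠ 0)])
  have hi2 : IntegrableOn (fun x => lam * η x ^ p) Ω := by
    refine (Continuous.integrable_of_hasCompactSupport
      (hη.continuous.rpow_const fun _ => Or.inr (by linarith)) ?_).integrableOn.const_mul lam
    exact hηc.comp_left (g := fun y => y ^ p) (Real.zero_rpow (by linarith : p ≠ 0))
  have hp2 : 0 < (p - 1) / 2 := by linarith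
  refine ⟨((∫ x in Ω, C₁ * ‖fderiv ℝ η x‖ ^ p) - ∫ x in Ω, lam * η x ^ p) / ((p - 1) / 2),
    fun ε hε => ?_⟩
  have hU : ∀ x ∈ Ω, 0 < u x + ε := fun x hx => by linarith [hu.nonneg hx]
  have hUc : ContinuousOn (fun x => u x + ε) Ω := hu.continuousOn.add continuousOn_const
  have hi0 : IntegrableOn (fun x => (η x * ‖gradient u x‖ / (u x + ε)) ^ p) Ω := by
    refine IntegrableOn.of_forall_sdiff_eq_zero (s := tsupport η) (t := Ω)
      (ContinuousOn.integrableOn_compact hηc ?_) hΩ.measurableSet fun x hx => ?_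
    · exact (((hη.continuous.continuousOn.mul hu.2.2.1.norm).div hUc
        fun x hx => (hU x hx).ne').rpow_const fun _ _ => Or.inr (by linarith)).mono hηΩ
    · rw [image_eq_zero_of_notMem_tsupport hx.2, zero_mul, zero_div,
        Real.zero_rpow (by linarith)]
  refine ⟨hi0, ?_⟩
  obtain ⟨hA, hR, h⟩ := hu.weak_identity hΩ hp hq ha hηc hηΩ
    (φ := fun x => η x ^ p * (u x + ε) ^ (1 - p))
    (φ' := fun x => (η x ^ p) • (((1 - p) * (u x + ε) ^ (1 - p - 1)) • fderiv ℝ u x)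
      + ((u x + ε) ^ (1 - p)) • ((p * η x ^ (p - 1)) • fderiv ℝ η x))
    (fun x hx => (((hη.differentiable one_ne_zero x).hasFDerivAt).rpow_const (Or.inr hp.le)).mul
      (((hu.hasFDerivAt hx).add_const ε).rpow_const (Or.inl (hU x hx).ne')))
    (by
      have h1 : ContinuousOn (fun x => η x ^ p) Ω :=
        (hη.continuous.rpow_const fun _ => Or.inr (by linarith)).continuousOn
      have h2 : ContinuousOn (fun x => η x ^ (p - 1)) Ω :=
        (hη.continuous.rpow_const fun _ => Or.inr (by linarith)).continuousOn
      have h3 : ∀ m : ℝ, ContinuousOn (fun x => (u x + ε) ^ m) Ω := fun m =>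
        hUc.rpow_const fun x hx => Or.inl (hU x hx).ne'
      exact (h1.smul (((h3 _).const_mul _).smul hu.continuousOn_fderiv)).add
        ((h3 _).smul ((h2.const_mul p).smul hηd.continuousOn)))
    (fun x _ hxK => by
      simp [image_eq_zero_of_notMem_tsupport hxK, Real.zero_rpow (by linarith : p ≠ 0)])
  rw [le_div_iff₀' hp2, ← integral_const_mul]
  have hpt : ∀ x ∈ Ω, (p - 1) / 2 * (η x * ‖gradient u x‖ / (u x + ε)) ^ p ≤
      C₁ * ‖fderiv ℝ η x‖ ^ p - ‖gradient u x‖ ^ (p - 2) *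
        ((η x ^ p) • (((1 - p) * (u x + ε) ^ (1 - p - 1)) • fderiv ℝ u x)
        + ((u x + ε) ^ (1 - p)) • ((p * η x ^ (p - 1)) • fderiv ℝ η x)) (gradient u x) := by
    intro x hx
    have hUx := hU x hx
    have h0 := hη0 x
    have h1 := hC₁ (η x * ‖gradient u x‖ / (u x + ε)) ‖fderiv ℝ η x‖ (by positivity)
      (norm_nonneg _)
    have h2 : fderiv ℝ η x (gradient u x) ≤ ‖fderiv ℝ η x‖ * ‖gradient u x‖ :=
      (le_abs_self _).trans ((fderiv ℝ η x).le_opNorm _)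
    have e1 := rpow_sub_two_mul_sq hp (norm_nonneg (gradient u x))
    have e2 := rpow_sub_two_mul_self hp (norm_nonneg (gradient u x))
    have e3 : (η x * ‖gradient u x‖ / (u x + ε)) ^ p
        = η x ^ p * (u x + ε) ^ (1 - p - 1) * ‖gradient u x‖ ^ p := by
      rw [Real.div_rpow (by positivity) hUx.le, Real.mul_rpow h0 (norm_nonneg _),
        show 1 - p - 1 = -p by ring, Real.rpow_neg hUx.le]
      ring
    have e4 : (η x * ‖gradient u x‖ / (u x + ε)) ^ (p - 1)
        = η x ^ (p - 1) * (u x + ε) ^ (1 - p) * ‖gradient u x‖ ^ (p - 1) := by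
      rw [Real.div_rpow (by positivity) hUx.le, Real.mul_rpow h0 (norm_nonneg _),
        show 1 - p = -(p - 1) by ring, Real.rpow_neg hUx.le]
      ring
    have h3 : ‖gradient u x‖ ^ (p - 2) * ((u x + ε) ^ (1 - p) * (p * η x ^ (p - 1)) *
        fderiv ℝ η x (gradient u x)) ≤ ‖gradient u x‖ ^ (p - 2) * ((u x + ε) ^ (1 - p) *
          (p * η x ^ (p - 1)) * (‖fderiv ℝ η x‖ * ‖gradient u x‖)) := by gcongr
    rw [e4, e3, ← e2] at h1
    simp only [add_apply, smul_apply, smul_eq_mul, ← inner_gradient_left (f := u),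
      real_inner_self_eq_norm_sq]
    rw [e3]
    rw [← e1] at h1 ⊢
    linarith
  have hle : ∫ x in Ω, (p - 1) / 2 * (η x * ‖gradient u x‖ / (u x + ε)) ^ p ≤
      ∫ x in Ω, (C₁ * ‖fderiv ℝ η x‖ ^ p - ‖gradient u x‖ ^ (p - 2) *
        ((η x ^ p) • (((1 - p) * (u x + ε) ^ (1 - p - 1)) • fderiv ℝ u x)
        + ((u x + ε) ^ (1 - p)) • ((p * η x ^ (p - 1)) • fderiv ℝ η x)) (gradient u x)) :=
    setIntegral_mono_on (hi0.const_mul _) (hi1.sub hA) hΩ.measurableSet hpt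
  rw [integral_sub hi1 hA, h] at hle
  have hle2 : ∫ x in Ω, lam * η x ^ p ≤
      ∫ x in Ω, (lam * u x ^ (p - 1) + a x * u x ^ (q - 1)) *
        (η x ^ p * (u x + ε) ^ (1 - p)) := by
    refine setIntegral_mono_on hi2 hR hΩ.measurableSet fun x hx => ?_
    have hUx := hU x hx
    have hux := hu.nonneg hx
    have h0 := hη0 x
    have h1 : 0 ≤ a x * u x ^ (q - 1) * (η x ^ p * (u x + ε) ^ (1 - p)) := by
      by_cases hxη : x ∈ tsupport η
      · have := haη x hxη
        positivity
      · simp [image_eq_zero_of_notMem_tsupport hxη, Real.zero_rpow (by linarith : p ≠ 0)]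
    have h2 : u x ^ (p - 1) * (u x + ε) ^ (1 - p) ≤ 1 := by
      rw [show 1 - p = -(p - 1) by ring, Real.rpow_neg hUx.le, ← div_eq_mul_inv]
      exact div_le_one_of_le₀ (Real.rpow_le_rpow hux (by linarith) (by linarith)) (by positivity)
    have h3 := mul_le_mul_of_nonpos_left h2
      (mul_nonpos_of_nonpos_of_nonneg hlam.le (by positivity : 0 ≤ η x ^ p))
    linarith
  linarith

end LogEstimate

section ZeroSet

open Set Metric Filter

variable {E : Type*} [NormedAddCommGroup E] [NormedSpace ℝ E] [MeasurableSpace E] [BorelSpace E]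
  {μ : Measure E} [SFinite μ] [μ.IsAddRightInvariant]

/-- Integrating the increments of `f` in direction `h` over a set of base points. -/
theorem ofReal_mul_measure_le_lintegral {f G : E → ℝ} {f' : E → E →L[ℝ] ℝ} {B S : Set E} {L : ℝ}
    {h : E} (hB : Convex ℝ B) (hf : ∀ x ∈ B, HasFDerivAt f (f' x) x) (hG : Continuous G)
    (hG0 : ∀ x, 0 ≤ G x) (hf' : ∀ x ∈ B, ‖f' x‖ ≤ G x) (hS : MeasurableSet S)
    (hSB : ∀ x ∈ S, x ∈ B ∧ x + h ∈ B) (hL : ∀ x ∈ S, L ≤ f (x + h) - f x) :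
    ENNReal.ofReal L * μ S ≤ ∫⁻ x, ENNReal.ofReal (G x * ‖h‖) ∂μ := by
  have hcont : Continuous fun z : E × ℝ => G (z.1 + z.2 • h) * ‖h‖ := by fun_prop
  have key : ∀ x ∈ S, ENNReal.ofReal L ≤
      ∫⁻ t in Ioc (0 : ℝ) 1, ENNReal.ofReal (G (x + t • h) * ‖h‖) := by
    intro x hx
    have hc : Continuous fun t : ℝ => G (x + t • h) * ‖h‖ := by fun_prop
    have hseg : ∀ t ∈ Icc (0 : ℝ) 1, x + t • h ∈ B := fun t ht =>
      hB.add_smul_mem (hSB x hx).1 (hSB x hx).2 ht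
    have hd : ∀ t ∈ Icc (0 : ℝ) 1,
        HasDerivAt (fun t : ℝ => f (x + t • h)) (f' (x + t • h) h) t := fun t ht => by
      have h1 : HasDerivAt (fun t : ℝ => x + t • h) ((1 : ℝ) • h) t :=
        ((hasDerivAt_id t).smul_const h).const_add x
      rw [one_smul] at h1
      exact (hf _ (hseg t ht)).comp_hasDerivAt t h1
    have h1 := intervalIntegral.sub_le_integral_of_hasDeriv_right_of_le zero_le_one
      (fun t ht => (hd t ht).continuousAt.continuousWithinAt)
      (fun t ht => (hd t (Ioo_subset_Icc_self ht)).hasDerivWithinAt)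
      (hc.integrableOn_Icc (μ := volume))
      (fun t ht => (le_abs_self _).trans (((f' (x + t • h)).le_opNorm h).trans
        (mul_le_mul_of_nonneg_right (hf' _ (hseg t (Ioo_subset_Icc_self ht)))
          (norm_nonneg h))))
    simp only [one_smul, zero_smul, add_zero] at h1
    rw [intervalIntegral.integral_of_le zero_le_one] at h1
    rw [← ofReal_integral_eq_lintegral_ofReal (hc.integrableOn_Ioc)
      (ae_of_all _ fun t => mul_nonneg (hG0 _) (norm_nonneg h))]
    exact ENNReal.ofReal_le_ofReal ((hL x hx).trans h1)
  calc ENNReal.ofReal L * μ S = ∫⁻ _ in S, ENNReal.ofReal L ∂μ := (setLIntegral_const _ _).symm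
    _ ≤ ∫⁻ x in S, (∫⁻ t in Ioc (0 : ℝ) 1, ENNReal.ofReal (G (x + t • h) * ‖h‖)) ∂μ :=
        setLIntegral_mono' hS key
    _ ≤ ∫⁻ x, (∫⁻ t in Ioc (0 : ℝ) 1, ENNReal.ofReal (G (x + t • h) * ‖h‖)) ∂μ :=
        setLIntegral_le_lintegral _ _
    _ = ∫⁻ t in Ioc (0 : ℝ) 1, ∫⁻ x, ENNReal.ofReal (G (x + t • h) * ‖h‖) ∂μ :=
        lintegral_lintegral_swap hcont.measurable.ennreal_ofReal.aemeasurable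
    _ = ∫⁻ _ in Ioc (0 : ℝ) 1, ∫⁻ x, ENNReal.ofReal (G x * ‖h‖) ∂μ := by
        congr 1
        ext t
        exact lintegral_add_right_eq_self (fun x => ENNReal.ofReal (G x * ‖h‖)) (t • h)
    _ = ∫⁻ x, ENNReal.ofReal (G x * ‖h‖) ∂μ := by simp

/-- If `log (w + ε)` has gradient bounded in `L¹` uniformly in `ε`, then the zero set of `w` in a
convex open set is either negligible or everything. -/
theorem measure_zeroSet_eq_zero_or_eqOn_zero [SecondCountableTopology E]
    [μ.IsAddLeftInvariant] [μ.IsOpenPosMeasure]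
    {w : E → ℝ} {w' : E → E →L[ℝ] ℝ}
    {B : Set E} (hB : Convex ℝ B) (hBo : IsOpen B) (hw : ∀ x ∈ B, HasFDerivAt w (w' x) x)
    (hw0 : ∀ x ∈ B, 0 ≤ w x) {D : ENNReal} (hD : D ≠ ⊤)
    (hlog : ∀ ε > 0, ∃ G : E → ℝ, Continuous G ∧ (∀ x, 0 ≤ G x) ∧
      (∀ x ∈ B, ‖w' x‖ ≤ G x * (w x + ε)) ∧ ∫⁻ x, ENNReal.ofReal (G x) ∂μ ≤ D) :
    μ {x | x ∈ B ∧ w x = 0} = 0 ∨ ∀ x ∈ B, w x = 0 := by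
  have hwc : ContinuousOn w B := fun x hx => (hw x hx).continuousAt.continuousWithinAt
  set W : E → ℝ := B.indicator w with hWdef
  have hWm : Measurable W := by
    classical
    have := hwc.measurable_piecewise (g := fun _ => (0 : ℝ)) continuousOn_const hBo.measurableSet
    rwa [hWdef, ← Set.piecewise_eq_indicator]
  have hW : ∀ x ∈ B, W x = w x := fun x hx => indicator_of_mem hx w
  have hnull : ∀ h : E, ∀ σ > 0,
      μ {x | (x ∈ B ∧ x + h ∈ B) ∧ W x = 0 ∧ σ ≤ W (x + h)} = 0 := by
    intro h σ hσ
    have hadd : Measurable fun x : E => x + h := measurable_add_const h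
    have hSm : MeasurableSet {x | (x ∈ B ∧ x + h ∈ B) ∧ W x = 0 ∧ σ ≤ W (x + h)} :=
      (hBo.measurableSet.inter (hadd hBo.measurableSet)).inter
        ((hWm (measurableSet_singleton 0)).inter ((hWm.comp hadd) measurableSet_Ici))
    set S := {x | (x ∈ B ∧ x + h ∈ B) ∧ W x = 0 ∧ σ ≤ W (x + h)} with hS
    have hbound : ∀ n : ℕ, (n : ENNReal) * μ S ≤ D * ENNReal.ofReal ‖h‖ := by
      intro n
      set ε := σ / Real.exp n with hε
      have hε0 : 0 < ε := div_pos hσ (Real.exp_pos _)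
      obtain ⟨G, hG, hG0, hGw, hGD⟩ := hlog ε hε0
      have hpos : ∀ x ∈ B, 0 < w x + ε := fun x hx => by linarith [hw0 x hx]
      have h1 := ofReal_mul_measure_le_lintegral (μ := μ) (S := S) (L := n) (h := h)
        (f := fun x => Real.log (w x + ε)) (f' := fun x => (w x + ε)⁻¹ • w' x) hB
        (fun x hx => ((hw x hx).add_const ε).log (hpos x hx).ne') hG hG0
        (fun x hx => by
          rw [norm_smul, norm_inv, Real.norm_of_nonneg (hpos x hx).le,
            inv_mul_le_iff₀ (hpos x hx), mul_comm]
          exact hGw x hx) hSm (fun x hx => hx.1)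
        (fun x hx => by
          obtain ⟨⟨hx1, hx2⟩, hx3, hx4⟩ := hx
          rw [hW _ hx1] at hx3
          rw [hW _ hx2] at hx4
          have h2 : Real.log σ ≤ Real.log (w (x + h) + ε) := Real.log_le_log hσ (by linarith)
          rw [hx3, zero_add, hε, Real.log_div hσ.ne' (Real.exp_pos _).ne', Real.log_exp]
          rw [hε] at h2
          linarith)
      rw [ENNReal.ofReal_natCast] at h1
      refine h1.trans ?_
      simp_rw [ENNReal.ofReal_mul (hG0 _)]
      rw [lintegral_mul_const _ hG.measurable.ennreal_ofReal]
      exact mul_le_mul_left hGD _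
    by_contra hne
    obtain ⟨n, hn⟩ := ENNReal.exists_nat_mul_gt hne
      (ENNReal.mul_ne_top hD ENNReal.ofReal_ne_top : D * ENNReal.ofReal ‖h‖ ≠ ⊤)
    exact (hbound n).not_gt hn
  have hae : ∀ h : E, ∀ᵐ x ∂μ, (x ∈ B ∧ x + h ∈ B) → W x = 0 → W (x + h) ≤ 0 := by
    intro h
    have h1 : ∀ n : ℕ, ∀ᵐ x ∂μ,
        ¬ ((x ∈ B ∧ x + h ∈ B) ∧ W x = 0 ∧ 1 / ((n : ℝ) + 1) ≤ W (x + h)) :=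
      fun n => measure_eq_zero_iff_ae_notMem.1 (hnull h _ Nat.one_div_pos_of_nat)
    filter_upwards [ae_all_iff.2 h1] with x hx hxB hx0
    by_contra! hpos
    obtain ⟨n, hn⟩ := exists_nat_one_div_lt hpos
    exact hx n ⟨hxB, hx0, hn.le⟩
  have hswap : ∀ᵐ x ∂μ, ∀ᵐ h ∂μ, (x ∈ B ∧ x + h ∈ B) → W x = 0 → W (x + h) ≤ 0 := by
    refine (Measure.ae_ae_comm ?_).1 (ae_of_all _ hae)
    have hadd : Measurable fun z : E × E => z.2 + z.1 := measurable_snd.add measurable_fst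
    have m1 : MeasurableSet {z : E × E | z.2 ∈ B ∧ z.2 + z.1 ∈ B} :=
      (measurable_snd hBo.measurableSet).inter (hadd hBo.measurableSet)
    have m2 : MeasurableSet {z : E × E | W z.2 = 0} :=
      (hWm.comp measurable_snd) (measurableSet_singleton 0)
    have m3 : MeasurableSet {z : E × E | W (z.2 + z.1) ≤ 0} :=
      (hWm.comp hadd) measurableSet_Iic
    exact m1.imp (m2.imp m3)
  by_cases hzero : μ {x | x ∈ B ∧ w x = 0} = 0
  · exact Or.inl hzero
  right
  obtain ⟨x, ⟨hxB, hx0⟩, hx⟩ : ∃ x, (x ∈ B ∧ w x = 0) ∧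
      ∀ᵐ h ∂μ, (x ∈ B ∧ x + h ∈ B) → W x = 0 → W (x + h) ≤ 0 := by
    by_contra hcon
    exact hzero (measure_mono_null (fun y hy hy' => hcon ⟨y, hy, hy'⟩) hswap)
  have hx' : ∀ᵐ y ∂μ, y ∈ B → w y = 0 := by
    have hmp := (measurePreserving_add_left μ (-x)).quasiMeasurePreserving.ae hx
    filter_upwards [hmp] with y hy hyB
    have h2 : x + (-x + y) = y := by abel
    rw [h2, hW y hyB, hW x hxB] at hy
    exact le_antisymm (hy ⟨hxB, hyB⟩ hx0) (hw0 y hyB)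
  exact Measure.eqOn_open_of_ae_eq ((ae_restrict_iff' hBo.measurableSet).2 hx') hBo hwc
    continuousOn_const

end ZeroSet

namespace DirichletSol

open Set Metric Filter

variable {N : ℕ} {Ω : Set (EuclideanSpace ℝ (Fin N))} {p q lam : ℝ}
  {a u : EuclideanSpace ℝ (Fin N) → ℝ}

theorem exists_ball_null_or_eqOn_zero (hu : DirichletSol Ω p q lam a u) (hΩ : IsOpen Ω)
    (hp : 1 < p) (hq : 1 < q) (ha : ContinuousOn a Ω) (hlam : lam < 0)
    {c : EuclideanSpace ℝ (Fin N)} (hc : c ∈ Ω) (hac : 0 < a c) :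
    ∃ r > 0, ball c r ⊆ {x | x ∈ Ω ∧ 0 < a x} ∧
      (volume {x | x ∈ ball c r ∧ u x = 0} = 0 ∨ ∀ x ∈ ball c r, u x = 0) := by
  have hA : IsOpen {x | x ∈ Ω ∧ 0 < a x} := ha.isOpen_inter_preimage hΩ isOpen_Ioi
  obtain ⟨R, hR, hRA⟩ := nhds_basis_closedBall.mem_iff.1 (hA.mem_nhds ⟨hc, hac⟩)
  have hrA : ball c (R / 2) ⊆ {x | x ∈ Ω ∧ 0 < a x} :=
    (ball_subset_closedBall.trans (closedBall_subset_closedBall (by linarith))).trans hRA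
  refine ⟨R / 2, half_pos hR, hrA, ?_⟩
  let η : ContDiffBump c := ⟨R / 2, R, half_pos hR, half_lt_self hR⟩
  have hηΩ : tsupport η ⊆ Ω := fun x hx => (hRA (η.tsupport_eq ▸ hx)).1
  have hU : ∀ ε > 0, ∀ x ∈ Ω, 0 < u x + ε := fun ε hε x hx => by linarith [hu.nonneg hx]
  obtain ⟨C, hC⟩ := hu.exists_log_gradient_bound hΩ hp hq ha hlam (η := η) η.contDiff
    η.hasCompactSupport hηΩ (fun x => η.nonneg)
    (fun x hx => (hRA (η.tsupport_eq ▸ hx)).2.le)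
  refine measure_zeroSet_eq_zero_or_eqOn_zero (w := u) (w' := fderiv ℝ u)
    (D := volume (tsupport η) + ENNReal.ofReal C) (convex_ball _ _) isOpen_ball
    (fun x hx => hu.hasFDerivAt (hrA hx).1) (fun x hx => hu.nonneg (hrA hx).1)
    (ENNReal.add_ne_top.2 ⟨η.hasCompactSupport.isCompact.measure_lt_top.ne,
      ENNReal.ofReal_ne_top⟩) fun ε hε => ?_
  obtain ⟨hi, hle⟩ := hC ε hε
  set G : EuclideanSpace ℝ (Fin N) → ℝ := fun x => η x * ‖gradient u x‖ / (u x + ε) with hG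
  have hGzero : ∀ x ∉ tsupport η, G x = 0 := fun x hx => by
    simp [hG, image_eq_zero_of_notMem_tsupport hx]
  have hGsupp : tsupport G ⊆ tsupport η :=
    closure_minimal (fun x hx => by_contra fun h => hx (hGzero x h)) (isClosed_tsupport _)
  have hGc : Continuous G := continuous_of_tsupport fun x hx => by
    have hxΩ := hηΩ (hGsupp hx)
    have hn := hΩ.mem_nhds hxΩ
    exact (η.continuous.continuousAt.mul (hu.2.2.1.continuousAt hn).norm).div
      ((hu.continuousOn.continuousAt hn).add continuousAt_const) (hU ε hε x hxΩ).ne'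
  have hG0 : ∀ x, 0 ≤ G x := fun x => by
    by_cases hx : x ∈ tsupport η
    · exact div_nonneg (mul_nonneg η.nonneg (norm_nonneg _)) (hU ε hε x (hηΩ hx)).le
    · exact (hGzero x hx).ge
  refine ⟨G, hGc, hG0, fun x hx => ?_, ?_⟩
  · have h1 : η x = 1 := η.one_of_mem_closedBall (ball_subset_closedBall hx)
    have h2 : ‖fderiv ℝ u x‖ = ‖gradient u x‖ := by
      rw [gradient, LinearIsometryEquiv.norm_map]
    simp only [hG]
    rw [h1, one_mul, div_mul_cancel₀ _ (hU ε hε x (hrA hx).1).ne', h2]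
  · have hpt : ∀ x, ENNReal.ofReal (G x) ≤ (tsupport η).indicator 1 x +
        Ω.indicator (fun x => ENNReal.ofReal (G x ^ p)) x := fun x => by
      by_cases hx : x ∈ tsupport η
      · rw [indicator_of_mem hx, indicator_of_mem (hηΩ hx), Pi.one_apply, ← ENNReal.ofReal_one,
          ← ENNReal.ofReal_add zero_le_one (Real.rpow_nonneg (hG0 x) _)]
        refine ENNReal.ofReal_le_ofReal ?_
        rcases le_total (G x) 1 with h | h
        · linarith [Real.rpow_nonneg (hG0 x) p]
        · linarith [Real.self_le_rpow_of_one_le h hp.le]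
      · simp [hGzero x hx]
    have hm : MeasurableSet (tsupport η) := (isClosed_tsupport _).measurableSet
    calc ∫⁻ x, ENNReal.ofReal (G x) ≤ ∫⁻ x, ((tsupport η).indicator 1 x +
        Ω.indicator (fun x => ENNReal.ofReal (G x ^ p)) x) := lintegral_mono hpt
      _ = volume (tsupport η) + ∫⁻ x in Ω, ENNReal.ofReal (G x ^ p) := by
        rw [lintegral_add_left (measurable_one.indicator hm), lintegral_indicator_one hm,
          lintegral_indicator hΩ.measurableSet]
      _ ≤ volume (tsupport η) + ENNReal.ofReal C := by
        rw [← ofReal_integral_eq_lintegral_ofReal hi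
          (ae_of_all _ fun x => Real.rpow_nonneg (hG0 x) p)]
        gcongr

/-- On a connected `Ω_a^+`, a nontrivial solution is positive almost everywhere. -/
theorem volume_zeroSet_eq_zero (hu : DirichletSol Ω p q lam a u) (hΩ : IsOpen Ω)
    (hΩb : Bornology.IsBounded Ω) (hp : 1 < p) (hq : 1 < q) (ha : ContinuousOn a Ω)
    (hlam : lam < 0) (hconn : IsPreconnected {x | x ∈ Ω ∧ 0 < a x}) (hnt : ∃ x ∈ Ω, u x ≠ 0) :
    volume {x | (x ∈ Ω ∧ 0 < a x) ∧ u x = 0} = 0 := by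
  choose! r hr hrA hdich using fun c (hc : c ∈ {x | x ∈ Ω ∧ 0 < a x}) =>
    hu.exists_ball_null_or_eqOn_zero hΩ hp hq ha hlam hc.1 hc.2
  set A := {x | x ∈ Ω ∧ 0 < a x} with hA
  set P := ⋃ c ∈ {c | c ∈ A ∧ volume {x | x ∈ ball c (r c) ∧ u x = 0} = 0}, ball c (r c) with hP
  set Z := ⋃ c ∈ {c | c ∈ A ∧ ∀ x ∈ ball c (r c), u x = 0}, ball c (r c) with hZ
  have hPo : IsOpen P := isOpen_biUnion fun _ _ => isOpen_ball
  have hZo : IsOpen Z := isOpen_biUnion fun _ _ => isOpen_ball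
  have hPn : ∀ x ∈ P, ∃ s ∈ nhds x, volume {y | y ∈ s ∧ u y = 0} = 0 := fun x hx => by
    obtain ⟨c, hc, hxc⟩ := mem_iUnion₂.1 hx
    exact ⟨_, isOpen_ball.mem_nhds hxc, hc.2⟩
  have hcover : A ⊆ P ∪ Z := fun c hc => (hdich c hc).imp
    (fun h => mem_biUnion (show c ∈ {c | _} from ⟨hc, h⟩) (mem_ball_self (hr c hc)))
    (fun h => mem_biUnion (show c ∈ {c | _} from ⟨hc, h⟩) (mem_ball_self (hr c hc)))
  have hZzero : ∀ x ∈ Z, u x = 0 := fun x hx => by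
    obtain ⟨c, hc, hxc⟩ := mem_iUnion₂.1 hx
    exact hc.2 x hxc
  have hdisj : A ∩ (P ∩ Z) = ∅ := by
    refine eq_empty_of_forall_notMem fun x hx => ?_
    obtain ⟨s, hs, hs0⟩ := hPn x hx.2.1
    have h1 : s ∩ Z ∈ nhds x := inter_mem hs (hZo.mem_nhds hx.2.2)
    exact (Measure.measure_pos_of_mem_nhds volume h1).ne'
      (measure_mono_null
        (show s ∩ Z ⊆ {y | y ∈ s ∧ u y = 0} from fun y hy => ⟨hy.1, hZzero y hy.2⟩) hs0)
  rcases isPreconnected_iff_subset_of_disjoint.1 hconn P Z hPo hZo hcover hdisj with h | h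
  · refine measure_null_of_locally_null _ fun x hx => ?_
    obtain ⟨s, hs, hs0⟩ := hPn x (h hx.1)
    exact ⟨{y | y ∈ A ∧ u y = 0} ∩ s, inter_mem_nhdsWithin _ hs,
      measure_mono_null (show _ ⊆ {y | y ∈ s ∧ u y = 0} from fun y hy => ⟨hy.2, hy.1.2⟩) hs0⟩
  · obtain ⟨x, hx, hax, hux⟩ := hu.exists_pos_of_nontrivial hΩ hΩb hp hq ha hlam hnt
    exact absurd (hZzero x (h ⟨hx, hax⟩)) hux

end DirichletSol

namespace DirichletSol

variable {N : ℕ} {Ω : Set (EuclideanSpace ℝ (Fin N))} {p q lam ε : ℝ}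
  {a u v : EuclideanSpace ℝ (Fin N) → ℝ}

theorem nonneg_of_mem_closure (hu : DirichletSol Ω p q lam a u) {x : EuclideanSpace ℝ (Fin N)}
    (hx : x ∈ closure Ω) : 0 ≤ u x := by
  by_cases h : x ∈ Ω
  · exact hu.nonneg h
  · exact (hu.2.2.2.2.1 x ⟨hx, fun h' => h (interior_subset h')⟩).ge

theorem continuousOn_add_rpow (hu : DirichletSol Ω p q lam a u) (hε : 0 < ε) (m : ℝ) :
    ContinuousOn (fun x => (u x + ε) ^ m) (closure Ω) :=
  (hu.1.add continuousOn_const).rpow_const fun x hx =>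
    Or.inl (by linarith [hu.nonneg_of_mem_closure hx] : 0 < u x + ε).ne'

theorem continuousOn_rhs_mul (hu : DirichletSol Ω p q lam a u) (hp : 1 < p) (hq : 1 < q)
    (ha : ContinuousOn a (closure Ω)) (hε : 0 < ε) :
    ContinuousOn (fun x => (lam * u x ^ (p - 1) + a x * u x ^ (q - 1)) * (u x + ε) ^ (1 - q))
      (closure Ω) :=
  (((hu.1.rpow_const fun _ _ => Or.inr (by linarith)).const_mul lam).add
    (ha.mul (hu.1.rpow_const fun _ _ => Or.inr (by linarith)))).mul (hu.continuousOn_add_rpow hε _)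

/-- Testing the equation of `u` with `T ((u+ε)^q - (v+ε)^q) (u+ε)^(1-q)`, where `T` vanishes near
`0`. -/
theorem weak_identity_truncated (hu : DirichletSol Ω p q lam a u) (hv : DirichletSol Ω p q lam a v)
    (hΩ : IsOpen Ω) (hΩb : Bornology.IsBounded Ω) (hp : 1 < p) (hq : 1 < q) (ha : ContinuousOn a Ω)
    (hε : 0 < ε) {T τ : ℝ → ℝ} {δ : ℝ} (hδ : 0 < δ) (hτ : Continuous τ)
    (hT : ∀ s, HasDerivAt T (τ s) s) (hT0 : ∀ s, |s| ≤ δ → T s = 0) :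
    IntegrableOn (fun x => ‖gradient u x‖ ^ (p - 2) *
      (τ ((u x + ε) ^ q - (v x + ε) ^ q) * (q * (u x + ε) ^ (q - 1) * ‖gradient u x‖ ^ 2
          - q * (v x + ε) ^ (q - 1) * ⟪gradient v x, gradient u x⟫) * (u x + ε) ^ (1 - q)
        + T ((u x + ε) ^ q - (v x + ε) ^ q) * ((1 - q) * (u x + ε) ^ (-q))
          * ‖gradient u x‖ ^ 2)) Ω ∧
    IntegrableOn (fun x => (lam * u x ^ (p - 1) + a x * u x ^ (q - 1)) *
      (T ((u x + ε) ^ q - (v x + ε) ^ q) * (u x + ε) ^ (1 - q))) Ω ∧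
    ∫ x in Ω, ‖gradient u x‖ ^ (p - 2) *
      (τ ((u x + ε) ^ q - (v x + ε) ^ q) * (q * (u x + ε) ^ (q - 1) * ‖gradient u x‖ ^ 2
          - q * (v x + ε) ^ (q - 1) * ⟪gradient v x, gradient u x⟫) * (u x + ε) ^ (1 - q)
        + T ((u x + ε) ^ q - (v x + ε) ^ q) * ((1 - q) * (u x + ε) ^ (-q)) * ‖gradient u x‖ ^ 2)
      = ∫ x in Ω, (lam * u x ^ (p - 1) + a x * u x ^ (q - 1)) *
        (T ((u x + ε) ^ q - (v x + ε) ^ q) * (u x + ε) ^ (1 - q)) := by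
  have hU : ∀ x ∈ Ω, 0 < u x + ε := fun x hx => by linarith [hu.nonneg hx]
  have hV : ∀ x ∈ Ω, 0 < v x + ε := fun x hx => by linarith [hv.nonneg hx]
  have hUc : ∀ m : ℝ, ContinuousOn (fun x => (u x + ε) ^ m) Ω := fun m =>
    (hu.continuousOn_add_rpow hε m).mono subset_closure
  have hVc : ∀ m : ℝ, ContinuousOn (fun x => (v x + ε) ^ m) Ω := fun m =>
    (hv.continuousOn_add_rpow hε m).mono subset_closure
  have hTc : Continuous T := continuous_iff_continuousAt.2 fun s => (hT s).continuousAt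
  have hsc : ContinuousOn (fun x => (u x + ε) ^ q - (v x + ε) ^ q) Ω := (hUc q).sub (hVc q)
  have h := hu.weak_identity hΩ hp hq ha
    (isCompact_superlevel hΩb (f := fun x => (u x + ε) ^ q - (v x + ε) ^ q) (δ := δ)
      ((hu.continuousOn_add_rpow hε q).sub (hv.continuousOn_add_rpow hε q)))
    (superlevel_subset hΩ (fun x hx => by
      simp only [hu.2.2.2.2.1 x hx, hv.2.2.2.2.1 x hx, sub_self]) hδ)
    (φ := fun x => T ((u x + ε) ^ q - (v x + ε) ^ q) * (u x + ε) ^ (1 - q))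
    (φ' := fun x => T ((u x + ε) ^ q - (v x + ε) ^ q) •
        (((1 - q) * (u x + ε) ^ (1 - q - 1)) • fderiv ℝ u x) +
      ((u x + ε) ^ (1 - q)) • (τ ((u x + ε) ^ q - (v x + ε) ^ q) •
        ((q * (u x + ε) ^ (q - 1)) • fderiv ℝ u x - (q * (v x + ε) ^ (q - 1)) • fderiv ℝ v x)))
    (fun x hx => ((hT _).comp_hasFDerivAt x
        ((((hu.hasFDerivAt hx).add_const ε).rpow_const (Or.inl (hU x hx).ne')).sub
          (((hv.hasFDerivAt hx).add_const ε).rpow_const (Or.inl (hV x hx).ne')))).mul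
      (((hu.hasFDerivAt hx).add_const ε).rpow_const (Or.inl (hU x hx).ne')))
    (((hTc.comp_continuousOn hsc).smul (((hUc _).const_mul _).smul hu.continuousOn_fderiv)).add
      ((hUc _).smul ((hτ.comp_continuousOn hsc).smul
        ((((hUc _).const_mul q).smul hu.continuousOn_fderiv).sub
          (((hVc _).const_mul q).smul hv.continuousOn_fderiv)))))
    (fun x hx hxK => by
      rw [hT0 _ (not_lt.1 fun h => hxK ⟨subset_closure hx, h.le⟩), zero_mul])
  have e : ∀ x, ‖gradient u x‖ ^ (p - 2) *
      (τ ((u x + ε) ^ q - (v x + ε) ^ q) * (q * (u x + ε) ^ (q - 1) * ‖gradient u x‖ ^ 2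
          - q * (v x + ε) ^ (q - 1) * ⟪gradient v x, gradient u x⟫) * (u x + ε) ^ (1 - q)
        + T ((u x + ε) ^ q - (v x + ε) ^ q) * ((1 - q) * (u x + ε) ^ (-q)) * ‖gradient u x‖ ^ 2)
      = ‖gradient u x‖ ^ (p - 2) * (T ((u x + ε) ^ q - (v x + ε) ^ q) •
        (((1 - q) * (u x + ε) ^ (1 - q - 1)) • fderiv ℝ u x) +
      ((u x + ε) ^ (1 - q)) • (τ ((u x + ε) ^ q - (v x + ε) ^ q) •
        ((q * (u x + ε) ^ (q - 1)) • fderiv ℝ u x - (q * (v x + ε) ^ (q - 1)) • fderiv ℝ v x)))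
          (gradient u x) := fun x => by
    simp only [add_apply, sub_apply, smul_apply, smul_eq_mul,
      ← inner_gradient_left (f := u), ← inner_gradient_left (f := v), real_inner_self_eq_norm_sq,
      show 1 - q - 1 = -q by ring]
    ring
  simp only [e]
  exact h

/-- A regularised form of the Díaz–Saá inequality for two solutions. -/
theorem integral_pairing_nonneg (hu : DirichletSol Ω p q lam a u) (hv : DirichletSol Ω p q lam a v)
    (hΩ : IsOpen Ω) (hΩb : Bornology.IsBounded Ω) (hq : 1 < q) (hqp : q < p)
    (ha : ContinuousOn a (closure Ω)) (hε : 0 < ε) :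
    0 ≤ ∫ x in Ω, ((lam * u x ^ (p - 1) + a x * u x ^ (q - 1)) * (u x + ε) ^ (1 - q)
      - (lam * v x ^ (p - 1) + a x * v x ^ (q - 1)) * (v x + ε) ^ (1 - q))
        * ((u x + ε) ^ q - (v x + ε) ^ q) := by
  have hp : 1 < p := hq.trans hqp
  set s : EuclideanSpace ℝ (Fin N) → ℝ := fun x => (u x + ε) ^ q - (v x + ε) ^ q with hs
  set B : EuclideanSpace ℝ (Fin N) → ℝ := fun x =>
    (lam * u x ^ (p - 1) + a x * u x ^ (q - 1)) * (u x + ε) ^ (1 - q)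
      - (lam * v x ^ (p - 1) + a x * v x ^ (q - 1)) * (v x + ε) ^ (1 - q) with hB
  have hcpt : IsCompact (closure Ω) := hΩb.isCompact_closure
  have hsc : ContinuousOn s (closure Ω) :=
    (hu.continuousOn_add_rpow hε q).sub (hv.continuousOn_add_rpow hε q)
  have hBc : ContinuousOn B (closure Ω) :=
    (hu.continuousOn_rhs_mul hp hq ha hε).sub (hv.continuousOn_rhs_mul hp hq ha hε)
  have hBi : IntegrableOn B Ω := (hBc.integrableOn_compact hcpt).mono_set subset_closure
  have hBsi : IntegrableOn (fun x => B x * s x) Ω :=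
    ((hBc.mul hsc).integrableOn_compact hcpt).mono_set subset_closure
  set D : EuclideanSpace ℝ (Fin N) → ℝ := fun x =>
    (q - 1) * ε ^ (-q) * (‖gradient u x‖ ^ p + ‖gradient v x‖ ^ p) + |B x| with hD
  have hgi : IntegrableOn (fun x =>
      (q - 1) * ε ^ (-q) * (‖gradient u x‖ ^ p + ‖gradient v x‖ ^ p)) Ω :=
    (hu.2.2.2.2.2.1.add hv.2.2.2.2.2.1).const_mul _
  have hDi : IntegrableOn D Ω := hgi.add hBi.abs
  have key : ∀ δ > 0, -(2 * δ * ∫ x in Ω, D x) ≤ ∫ x in Ω, B x * s x := by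
    intro δ hδ
    obtain ⟨T, τ, hτc, hTd, hτ0, hT0, -, hTs, hTτ⟩ := exists_soft_threshold hδ
    obtain ⟨hu1, hu2, hu3⟩ := hu.weak_identity_truncated hv hΩ hΩb hp hq
      (ha.mono subset_closure) hε hδ hτc hTd hT0
    obtain ⟨hv1, hv2, hv3⟩ := hv.weak_identity_truncated hu hΩ hΩb hp hq
      (ha.mono subset_closure) hε hδ (τ := fun r => τ (-r)) (T := fun r => -T (-r))
      (hτc.comp continuous_neg)
      (fun r => ((hTd (-r)).comp r (hasDerivAt_neg r)).neg.congr_deriv (by simp))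
      (fun r hr => by rw [hT0 _ (by rwa [abs_neg]), neg_zero])
    simp only [neg_sub] at hv1 hv2 hv3
    have h1 := integral_add hu1 hv1
    have h2 := integral_add hu2 hv2
    rw [hu3, hv3, ← h2] at h1
    have hle1 : ∫ x in Ω, -(2 * δ *
        ((q - 1) * ε ^ (-q) * (‖gradient u x‖ ^ p + ‖gradient v x‖ ^ p))) ≤ _ :=
      setIntegral_mono_on (hgi.const_mul (2 * δ)).neg (hu1.add hv1) hΩ.measurableSet
        fun x hx => by
          refine (picone_truncated hq hqp hε (by linarith [hu.nonneg hx] : ε ≤ u x + ε)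
            (by linarith [hv.nonneg hx] : ε ≤ v x + ε) (hτ0 (s x)) (hTτ (s x))
            (gradient u x) (gradient v x)).trans (le_of_eq ?_)
          simp only [Pi.add_apply, hs]
          ring
    have hle2 : ∫ x in Ω, (_ - 2 * δ * |B x|) ≤ ∫ x in Ω, B x * s x :=
      setIntegral_mono_on ((hu2.add hv2).sub (hBi.abs.const_mul (2 * δ))) hBsi hΩ.measurableSet
        fun x hx => by
          have h3 : B x * (T (s x) - s x) ≤ 2 * δ * |B x| := by
            rw [mul_comm (2 * δ)]
            refine (le_abs_self _).trans ?_
            rw [abs_mul]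
            exact mul_le_mul_of_nonneg_left (hTs _) (abs_nonneg _)
          have h4 : B x * T (s x) - 2 * δ * |B x| ≤ B x * s x := by linarith
          refine le_trans (le_of_eq ?_) h4
          simp only [Pi.add_apply, hs, hB]
          ring
    rw [integral_sub (hu2.add hv2) (hBi.abs.const_mul (2 * δ))] at hle2
    have h4 : ∫ x in Ω, D x = (∫ x in Ω,
        (q - 1) * ε ^ (-q) * (‖gradient u x‖ ^ p + ‖gradient v x‖ ^ p)) + ∫ x in Ω, |B x| :=
      integral_add hgi hBi.abs
    simp only [integral_neg, integral_const_mul, Pi.add_apply] at hle1 hle2 h1 h4 ⊢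
    rw [h4]
    linarith
  have hD0 : 0 ≤ ∫ x in Ω, D x := integral_nonneg fun x => by
    have : 0 < q - 1 := by linarith
    simp only [hD, Pi.zero_apply]
    positivity
  by_contra! hneg
  set I := ∫ x in Ω, D x with hI
  set R := ∫ x in Ω, B x * s x with hR
  have h1 := key (-R / (4 * (I + 1))) (div_pos (by linarith) (by linarith))
  have h2 : 2 * (-R / (4 * (I + 1))) * I = -R / 2 * (I / (I + 1)) := by
    field_simp
    ring
  have h3 : I / (I + 1) ≤ 1 := div_le_one_of_le₀ (by linarith) (by linarith)
  rw [h2] at h1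
  nlinarith

end DirichletSol

section Limit

open Filter Topology

theorem rpow_mul_add_rpow_le {p q s ε : ℝ} (hq : 1 < q) (hqp : q < p) (hs : 0 ≤ s) (hε : 0 < ε) :
    s ^ (q - 1) * (s + ε) ^ (1 - q) ≤ 1 ∧
      s ^ (p - 1) * (s + ε) ^ (1 - q) ≤ s ^ (p - q) := by
  have h1 : s ^ (q - 1) * (s + ε) ^ (1 - q) ≤ 1 := by
    rw [show 1 - q = -(q - 1) by ring, Real.rpow_neg (by linarith), ← div_eq_mul_inv]
    exact div_le_one_of_le₀ (Real.rpow_le_rpow hs (by linarith) (by linarith))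
      (Real.rpow_nonneg (by linarith) _)
  refine ⟨h1, ?_⟩
  rw [show p - 1 = (p - q) + (q - 1) by ring,
    Real.rpow_add_of_nonneg hs (by linarith) (by linarith), mul_assoc]
  exact mul_le_of_le_one_right (Real.rpow_nonneg hs _) h1

theorem abs_rhs_mul_add_rpow_le {p q s ε lam α : ℝ} (hq : 1 < q) (hqp : q < p) (hs : 0 ≤ s)
    (hε : 0 < ε) : |(lam * s ^ (p - 1) + α * s ^ (q - 1)) * (s + ε) ^ (1 - q)| ≤
      |lam| * s ^ (p - q) + |α| := by
  obtain ⟨h1, h2⟩ := rpow_mul_add_rpow_le hq hqp hs hε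
  have h0 : 0 ≤ (s + ε) ^ (1 - q) := Real.rpow_nonneg (by linarith) _
  have e : (lam * s ^ (p - 1) + α * s ^ (q - 1)) * (s + ε) ^ (1 - q) =
      lam * (s ^ (p - 1) * (s + ε) ^ (1 - q)) + α * (s ^ (q - 1) * (s + ε) ^ (1 - q)) := by ring
  rw [e]
  refine (abs_add_le _ _).trans (add_le_add ?_ ?_)
  · rw [abs_mul, abs_of_nonneg (mul_nonneg (Real.rpow_nonneg hs _) h0)]
    gcongr
  · rw [abs_mul, abs_of_nonneg (mul_nonneg (Real.rpow_nonneg hs _) h0)]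
    exact mul_le_of_le_one_right (abs_nonneg _) h1

theorem tendsto_rhs_mul_add_rpow {p q s lam α : ℝ} (hq : 1 < q) (hqp : q < p) (hs : 0 ≤ s)
    {e : ℕ → ℝ} (he : Tendsto e atTop (𝓝 0)) :
    Tendsto (fun n => (lam * s ^ (p - 1) + α * s ^ (q - 1)) * (s + e n) ^ (1 - q)) atTop
      (𝓝 (lam * s ^ (p - q) + α * (if s = 0 then 0 else 1))) := by
  rcases hs.eq_or_lt with rfl | hs
  · simp [Real.zero_rpow (by linarith : p - 1 ≠ 0), Real.zero_rpow (by linarith : q - 1 ≠ 0),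
      Real.zero_rpow (by linarith : p - q ≠ 0)]
  · have h1 : Tendsto (fun n => (s + e n) ^ (1 - q)) atTop (𝓝 (s ^ (1 - q))) := by
      have h2 : Tendsto (fun n => s + e n) atTop (𝓝 s) := by simpa using he.const_add s
      exact h2.rpow_const (Or.inl hs.ne')
    convert h1.const_mul (lam * s ^ (p - 1) + α * s ^ (q - 1)) using 2
    rw [if_neg hs.ne', add_mul, mul_assoc, mul_assoc, ← Real.rpow_add hs, ← Real.rpow_add hs]
    simp

end Limit

namespace DirichletSol

open Filter Topology

variable {N : ℕ} {Ω : Set (EuclideanSpace ℝ (Fin N))} {p q lam : ℝ}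
  {a u v : EuclideanSpace ℝ (Fin N) → ℝ}

/-- The limit `ε → 0` of the regularised Díaz–Saá inequality. -/
theorem integrableOn_pairing_and_integral_nonneg (hu : DirichletSol Ω p q lam a u)
    (hv : DirichletSol Ω p q lam a v)
    (hΩ : IsOpen Ω) (hΩb : Bornology.IsBounded Ω) (hq : 1 < q) (hqp : q < p)
    (ha : ContinuousOn a (closure Ω)) :
    IntegrableOn (fun x => ((lam * u x ^ (p - q) + a x * (if u x = 0 then 0 else 1))
      - (lam * v x ^ (p - q) + a x * (if v x = 0 then 0 else 1))) * (u x ^ q - v x ^ q)) Ω ∧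
    0 ≤ ∫ x in Ω, ((lam * u x ^ (p - q) + a x * (if u x = 0 then 0 else 1))
      - (lam * v x ^ (p - q) + a x * (if v x = 0 then 0 else 1))) * (u x ^ q - v x ^ q) := by
  have hp : 1 < p := hq.trans hqp
  have hcpt : IsCompact (closure Ω) := hΩb.isCompact_closure
  set e : ℕ → ℝ := fun n => 1 / ((n : ℝ) + 1) with he
  have he0 : ∀ n, 0 < e n := fun n => Nat.one_div_pos_of_nat
  have he1 : ∀ n, e n ≤ 1 := fun n => by
    rw [he]
    exact div_le_one_of_le₀ (by linarith [n.cast_nonneg (α := ℝ)]) (by positivity)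
  have helim : Tendsto e atTop (𝓝 0) := tendsto_one_div_add_atTop_nhds_zero_nat
  set F : ℕ → EuclideanSpace ℝ (Fin N) → ℝ := fun n x =>
    ((lam * u x ^ (p - 1) + a x * u x ^ (q - 1)) * (u x + e n) ^ (1 - q)
      - (lam * v x ^ (p - 1) + a x * v x ^ (q - 1)) * (v x + e n) ^ (1 - q))
        * ((u x + e n) ^ q - (v x + e n) ^ q) with hF
  set b : EuclideanSpace ℝ (Fin N) → ℝ := fun x =>
    ((|lam| * u x ^ (p - q) + |a x|) + (|lam| * v x ^ (p - q) + |a x|)) *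
      ((u x + 1) ^ q + (v x + 1) ^ q) with hb
  have hbi : IntegrableOn b Ω := by
    have hc : ∀ {w}, DirichletSol Ω p q lam a w →
        ContinuousOn (fun x => |lam| * w x ^ (p - q) + |a x|) (closure Ω) := fun hw =>
      ((hw.1.rpow_const fun _ _ => Or.inr (by linarith)).const_mul _).add ha.abs
    exact ((((hc hu).add (hc hv)).mul ((hu.continuousOn_add_rpow one_pos q).add
      (hv.continuousOn_add_rpow one_pos q))).integrableOn_compact hcpt).mono_set subset_closure
  have hFm : ∀ n, AEStronglyMeasurable (F n) (volume.restrict Ω) := fun n =>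
    ((((hu.continuousOn_rhs_mul hp hq ha (he0 n)).sub
      (hv.continuousOn_rhs_mul hp hq ha (he0 n))).mul
      ((hu.continuousOn_add_rpow (he0 n) q).sub (hv.continuousOn_add_rpow (he0 n) q))).mono
        subset_closure).aestronglyMeasurable hΩ.measurableSet
  have hFb : ∀ n, ∀ᵐ x ∂volume.restrict Ω, ‖F n x‖ ≤ b x := fun n => by
    refine (ae_restrict_iff' hΩ.measurableSet).2 (ae_of_all _ fun x hx => ?_)
    have hux := hu.nonneg hx
    have hvx := hv.nonneg hx
    have hm : ∀ w : ℝ, 0 ≤ w → |(w + e n) ^ q| ≤ (w + 1) ^ q := fun w hw => by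
      have := he0 n
      rw [abs_of_nonneg (by positivity)]
      exact Real.rpow_le_rpow (by positivity) (by linarith [he1 n]) (by linarith)
    rw [hF, Real.norm_eq_abs, abs_mul]
    refine mul_le_mul ?_ ?_ (abs_nonneg _) (by positivity)
    · exact (abs_sub _ _).trans (add_le_add (abs_rhs_mul_add_rpow_le hq hqp hux (he0 n))
        (abs_rhs_mul_add_rpow_le hq hqp hvx (he0 n)))
    · exact (abs_sub _ _).trans (add_le_add (hm _ hux) (hm _ hvx))
  have hlim : ∀ᵐ x ∂volume.restrict Ω, Tendsto (fun n => F n x) atTop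
      (𝓝 (((lam * u x ^ (p - q) + a x * (if u x = 0 then 0 else 1))
      - (lam * v x ^ (p - q) + a x * (if v x = 0 then 0 else 1))) * (u x ^ q - v x ^ q))) := by
    refine (ae_restrict_iff' hΩ.measurableSet).2 (ae_of_all _ fun x hx => ?_)
    have hq' : ∀ w : ℝ, Tendsto (fun n => (w + e n) ^ q) atTop (𝓝 (w ^ q)) := fun w => by
      have h2 : Tendsto (fun n => w + e n) atTop (𝓝 w) := by simpa using helim.const_add w
      exact h2.rpow_const (Or.inr (by linarith))
    exact ((tendsto_rhs_mul_add_rpow hq hqp (hu.nonneg hx) helim).sub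
      (tendsto_rhs_mul_add_rpow hq hqp (hv.nonneg hx) helim)).mul ((hq' _).sub (hq' _))
  refine ⟨⟨aestronglyMeasurable_of_tendsto_ae atTop hFm hlim,
    hasFiniteIntegral_of_dominated_convergence hbi.2 hFb hlim⟩, ?_⟩
  exact ge_of_tendsto' (tendsto_integral_of_dominated_convergence b hFm hbi hFb hlim)
    fun n => hu.integral_pairing_nonneg hv hΩ hΩb hq hqp ha (he0 n)

end DirichletSol

/-- For `λ < 0`, if `Ω_a^+` is connected then `(P_λ)` has at most one nontrivial
Dirichlet weak solution. -/
theorem at_most_one_nontrivial_solution_of_connected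
    {N : ℕ} (hN : 1 ≤ N) (Ω : Set (EuclideanSpace ℝ (Fin N)))
    (hΩne : Ω.Nonempty) (hΩo : IsOpen Ω) (hΩb : Bornology.IsBounded Ω)
    (p q : ℝ) (h1q : 1 < q) (hqp : q < p)
    (a : EuclideanSpace ℝ (Fin N) → ℝ) (ha : ContinuousOn a (closure Ω))
    (haplus : ∃ x ∈ Ω, 0 < a x) (haminus : ∃ x ∈ Ω, a x < 0)
    (hconn : IsConnected {x | x ∈ Ω ∧ 0 < a x})
    (lam : ℝ) (hlam : lam < 0)
    (u v : EuclideanSpace ℝ (Fin N) → ℝ)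
    (hu : DirichletSol Ω p q lam a u) (hv : DirichletSol Ω p q lam a v)
    (hunt : ∃ x ∈ Ω, u x ≠ 0) (hvnt : ∃ x ∈ Ω, v x ≠ 0) :
    ∀ x ∈ Ω, u x = v x := by
  have hp : 1 < p := h1q.trans hqp
  have ha' : ContinuousOn a Ω := ha.mono subset_closure
  obtain ⟨hPi, hP0⟩ := hu.integrableOn_pairing_and_integral_nonneg hv hΩo hΩb h1q hqp ha
  set H : EuclideanSpace ℝ (Fin N) → ℝ := fun x =>
    lam * ((u x ^ (p - q) - v x ^ (p - q)) * (u x ^ q - v x ^ q)) with hH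
  have hHc : ContinuousOn H (closure Ω) := by
    have hc : ∀ {w} {m : ℝ}, DirichletSol Ω p q lam a w → 0 < m →
        ContinuousOn (fun x => w x ^ m) (closure Ω) := fun hw hm =>
      hw.1.rpow_const fun _ _ => Or.inr hm.le
    have hpq : 0 < p - q := by linarith
    have hq : 0 < q := by linarith
    exact (((hc hu hpq).sub (hc hv hpq)).mul ((hc hu hq).sub (hc hv hq))).const_mul lam
  have hHi : IntegrableOn H Ω :=
    (hHc.integrableOn_compact hΩb.isCompact_closure).mono_set subset_closure
  have hHle : ∀ x ∈ Ω, H x ≤ 0 := fun x hx =>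
    mul_nonpos_of_nonpos_of_nonneg hlam.le (rpow_sub_mul_rpow_sub_nonneg (by linarith)
      (by linarith) (hu.nonneg hx) (hv.nonneg hx))
  have hzu := measure_eq_zero_iff_ae_notMem.1 (hu.volume_zeroSet_eq_zero hΩo hΩb hp h1q ha' hlam
    hconn.isPreconnected hunt)
  have hzv := measure_eq_zero_iff_ae_notMem.1 (hv.volume_zeroSet_eq_zero hΩo hΩb hp h1q ha' hlam
    hconn.isPreconnected hvnt)
  have hle : ∀ᵐ x ∂volume.restrict Ω, ((lam * u x ^ (p - q) + a x * (if u x = 0 then 0 else 1))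
      - (lam * v x ^ (p - q) + a x * (if v x = 0 then 0 else 1))) * (u x ^ q - v x ^ q) ≤ H x := by
    refine (ae_restrict_iff' hΩo.measurableSet).2 ?_
    filter_upwards [hzu, hzv] with x hxu hxv hx
    have hq0 : q ≠ 0 := by linarith
    have h0 : a x * (((if u x = 0 then 0 else 1) - (if v x = 0 then 0 else 1))
        * (u x ^ q - v x ^ q)) ≤ 0 := by
      rcases le_or_gt (a x) 0 with hax | hax
      · refine mul_nonpos_of_nonpos_of_nonneg hax ?_
        have hu1 := Real.rpow_nonneg (hu.nonneg hx) q
        have hv1 := Real.rpow_nonneg (hv.nonneg hx) q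
        split_ifs with h1 h2 h2 <;> simp [*, Real.zero_rpow]
      · rw [if_neg fun h => hxu ⟨⟨hx, hax⟩, h⟩, if_neg fun h => hxv ⟨⟨hx, hax⟩, h⟩]
        simp
    rw [hH]
    linarith
  have hH0 : 0 ≤ ∫ x in Ω, H x := hP0.trans (integral_mono_ae hPi hHi hle)
  intro x hx
  have h1 := eqOn_zero_of_integral_nonneg hΩo (hHc.mono subset_closure) hHle hHi hH0 x hx
  rcases mul_eq_zero.1 ((mul_eq_zero.1 h1).resolve_left hlam.ne) with h | h
  · exact Real.rpow_left_injOn (by linarith : p - q ≠ 0) (hu.nonneg hx) (hv.nonneg hx)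
      (sub_eq_zero.1 h)
  · exact Real.rpow_left_injOn (by linarith : q ≠ 0) (hu.nonneg hx) (hv.nonneg hx)
      (sub_eq_zero.1 h)
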